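/- arXiv:math/0604594 — 3 statements merged into one kernel-verified Lean document; each statement's English description precedes it below -/
import Mathlib

section
/- There exists a universal constant C > 0 with the following property. Let K ⊂ ℝⁿ be a centrally symmetric convex body of volume 1 which is 2-convex with constant α > 0. Then there exists a unit vector θ ∈ S^{n−1} such that ‖⟨·,θ⟩‖_{ψ₂(K)} ≤ C/√α. -/
open MeasureTheory
open scoped RealInnerProductSpace

noncomputable section

/-- A centrally symmetric convex body: compact, convex, with nonempty interior,
and symmetric about the origin. -/
def IsSymmConvexBody {E : Type*} [NormedAddCommGroup E] [NormedSpace ℝ E]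
    (K : Set E) : Prop :=
  IsCompact K ∧ Convex ℝ K ∧ (interior K).Nonempty ∧ K = -K

/-- The modulus of convexity of `K`, defined via the gauge (Minkowski functional) of `K`. -/
def modulusOfConvexity {E : Type*} [AddCommGroup E] [Module ℝ E]
    (K : Set E) (ε : ℝ) : ℝ :=
  sInf { d | ∃ x y : E, gauge K x ≤ 1 ∧ gauge K y ≤ 1 ∧ ε ≤ gauge K (x - y) ∧
    d = 1 - gauge K ((2:ℝ)⁻¹ • (x + y)) }

/-- `K` is 2-convex with constant `α`: `δ_K(ε) ≥ α ε²` for all `0 < ε ≤ 2`. -/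
def IsTwoConvex {E : Type*} [AddCommGroup E] [Module ℝ E]
    (K : Set E) (α : ℝ) : Prop :=
  ∀ ε : ℝ, 0 < ε → ε ≤ 2 → α * ε ^ 2 ≤ modulusOfConvexity K ε

/-- The dual norm `‖θ‖*_K = sup_{y ∈ K} ⟨θ, y⟩`. -/
def dualNorm {n : ℕ} (K : Set (EuclideanSpace ℝ (Fin n)))
    (θ : EuclideanSpace ℝ (Fin n)) : ℝ :=
  sSup ((fun y => ⟪θ, y⟫) '' K)

/-- The `ψ₂`-norm of the linear functional `⟨·, θ⟩` w.r.t. the uniform measure on `K`: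
`inf { λ > 0 : (1/|K|) ∫_K exp(⟨x,θ⟩²/λ²) dx ≤ 2 }`. -/
def psiTwoNorm {n : ℕ} (K : Set (EuclideanSpace ℝ (Fin n)))
    (θ : EuclideanSpace ℝ (Fin n)) : ℝ :=
  sInf { l : ℝ | 0 < l ∧
    (volume K).toReal⁻¹ * ∫ x in K, Real.exp (⟪x, θ⟫ ^ 2 / l ^ 2) ≤ 2 }

open scoped ENNReal NNReal Pointwise

theorem Real.volume_add_volume_le_of_isCompact {A B H : Set ℝ} (hA : IsCompact A)
    (hB : IsCompact B) (hA₀ : A.Nonempty) (hB₀ : B.Nonempty)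
    (h : ∀ x ∈ A, ∀ y ∈ B, x + y ∈ H) : volume A + volume B ≤ volume H := by
  have ha := hA.sSup_mem hA₀
  have hb := hB.sInf_mem hB₀
  set a := sSup A
  set b := sInf B
  have hsub : ((fun x => x + b) '' A) ∪ ((fun y => a + y) '' B) ⊆ H := by
    rintro _ (⟨x, hx, rfl⟩ | ⟨y, hy, rfl⟩)
    · exact h x hx b hb
    · exact h a ha y hy
  have hdisj : AEDisjoint volume ((fun x => x + b) '' A) ((fun y => a + y) '' B) := by
    refine measure_mono_null (t := {a + b}) ?_ Real.volume_singleton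
    rintro _ ⟨⟨x, hx, rfl⟩, ⟨y, hy, hxy⟩⟩
    have h₁ : x ≤ a := le_csSup hA.bddAbove hx
    have h₂ : b ≤ y := csInf_le hB.bddBelow hy
    simp only [Set.mem_singleton_iff] at hxy ⊢
    linarith
  have hmeas : NullMeasurableSet ((fun y => a + y) '' B) volume :=
    (hB.image (by fun_prop)).measurableSet.nullMeasurableSet
  calc volume A + volume B
      = volume ((fun x => x + b) '' A) + volume ((fun y => a + y) '' B) := by
        simp [Set.image_add_right, Set.image_add_left]
    _ = volume (((fun x => x + b) '' A) ∪ ((fun y => a + y) '' B)) :=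
        (measure_union₀ hmeas hdisj).symm
    _ ≤ volume H := measure_mono hsub

theorem Real.volume_add_volume_le_two_mul {A B H : Set ℝ} (hA : MeasurableSet A)
    (hB : MeasurableSet B) (hA₀ : A.Nonempty) (hB₀ : B.Nonempty)
    (h : ∀ x ∈ A, ∀ y ∈ B, (2⁻¹ : ℝ) • (x + y) ∈ H) :
    volume A + volume B ≤ 2 * volume H := by
  have key : ∀ A' ⊆ A, ∀ B' ⊆ B, IsCompact A' → IsCompact B' → A'.Nonempty → B'.Nonempty →
      volume A' + volume B' ≤ 2 * volume H := by
    intro A' hA' B' hB' hAc hBc hAn hBn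
    have := Real.volume_add_volume_le_of_isCompact (H := (2 : ℝ) • H) hAc hBc hAn hBn
      fun x hx y hy => ⟨_, h x (hA' hx) y (hB' hy), by simp⟩
    rwa [Measure.addHaar_smul, Module.finrank_self, pow_one, abs_two, ENNReal.ofReal_ofNat] at this
  rw [hA.measure_eq_iSup_isCompact, hB.measure_eq_iSup_isCompact]
  obtain ⟨a, ha⟩ := hA₀
  obtain ⟨b, hb⟩ := hB₀
  simp only [iSup_and']
  refine ENNReal.biSup_add_biSup_le' ⟨∅, by simp⟩ ⟨∅, by simp⟩ ?_
  rintro A' ⟨hA', hAc⟩ B' ⟨hB', hBc⟩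
  calc volume A' + volume B' ≤ volume (insert a A') + volume (insert b B') := by
        gcongr <;> exact Set.subset_insert _ _
    _ ≤ 2 * volume H := key _ (Set.insert_subset ha hA') _ (Set.insert_subset hb hB')
        (hAc.insert a) (hBc.insert b) (Set.insert_nonempty _ _) (Set.insert_nonempty _ _)

theorem ENNReal.mul_le_sq_of_add_le_two_mul {x y z : ℝ≥0∞} (h : x + y ≤ 2 * z) :
    x * y ≤ z ^ 2 := by
  rcases eq_or_ne z ∞ with rfl | hz
  · simp
  have hxy : x + y ≠ ∞ := ne_top_of_le_ne_top (by finiteness) h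
  have hx : x ≠ ∞ := fun hx => hxy (by simp [hx])
  have hy : y ≠ ∞ := fun hy => hxy (by simp [hy])
  lift x to ℝ≥0 using hx
  lift y to ℝ≥0 using hy
  lift z to ℝ≥0 using hz
  norm_cast at h ⊢
  rw [← NNReal.coe_le_coe] at h ⊢
  push_cast at h ⊢
  nlinarith [sq_nonneg ((x : ℝ) - y), x.2, y.2, z.2]

theorem lintegral_add_lintegral_le_of_normalized {f g h : ℝ → ℝ≥0∞} (hf : Measurable f)
    (hg : Measurable g) (hh : Measurable h) (hf₁ : ⨆ x, f x = 1) (hg₁ : ⨆ x, g x = 1)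
    (H : ∀ x y, f x * g y ≤ h ((2⁻¹ : ℝ) • (x + y)) ^ 2) :
    (∫⁻ x, f x) + ∫⁻ x, g x ≤ 2 * ∫⁻ x, h x := by
  have layer : ∀ φ : ℝ → ℝ≥0∞, Measurable φ → (∀ x, φ x ≤ 1) →
      ∫⁻ x, φ x = ∫⁻ t in Set.Ioi (0 : ℝ), volume {x | ENNReal.ofReal t < φ x} := by
    intro φ hφ hφ₁
    have hfin : ∀ x, φ x ≠ ∞ := fun x => ne_top_of_le_ne_top ENNReal.one_ne_top (hφ₁ x)
    have := lintegral_eq_lintegral_meas_lt (f := fun x => (φ x).toReal) volume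
      (Filter.Eventually.of_forall fun x => ENNReal.toReal_nonneg) hφ.ennreal_toReal.aemeasurable
    simp only [ENNReal.ofReal_toReal (hfin _)] at this
    rw [this]
    refine setLIntegral_congr_fun measurableSet_Ioi fun t ht => ?_
    congr 1
    ext x
    exact (ENNReal.ofReal_lt_iff_lt_toReal (le_of_lt ht) (hfin x)).symm
  have hf_le : ∀ x, f x ≤ 1 := fun x => hf₁ ▸ le_iSup f x
  have hg_le : ∀ x, g x ≤ 1 := fun x => hg₁ ▸ le_iSup g x
  have hmono : ∫⁻ x, min (h x) 1 ≤ ∫⁻ x, h x := lintegral_mono fun x => min_le_left _ _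
  refine le_trans ?_ (mul_le_mul_right hmono 2)
  rw [layer f hf hf_le, layer g hg hg_le,
    layer _ (hh.min measurable_const) fun x => min_le_right _ _,
    ← lintegral_const_mul' _ _ (by finiteness), ← lintegral_add_left']
  · refine lintegral_mono fun t => ?_
    rcases le_or_gt 1 (ENNReal.ofReal t) with ht | ht
    · simp [fun x => ((hf_le x).trans ht).not_gt, fun x => ((hg_le x).trans ht).not_gt]
    · refine Real.volume_add_volume_le_two_mul (measurableSet_lt measurable_const hf)
        (measurableSet_lt measurable_const hg) ?_ ?_ ?_
      · exact lt_iSup_iff.1 (hf₁ ▸ ht)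
      · exact lt_iSup_iff.1 (hg₁ ▸ ht)
      · intro x hx y hy
        refine lt_min ?_ ht
        have hlt : ENNReal.ofReal t ^ 2 < h ((2⁻¹ : ℝ) • (x + y)) ^ 2 := by
          rw [sq]
          exact (ENNReal.mul_lt_mul hx hy).trans_le (H x y)
        exact lt_of_not_ge fun hle => hlt.not_ge (pow_le_pow_left' hle 2)
  · refine Antitone.measurable (fun s t hst => measure_mono fun x hx => ?_) |>.aemeasurable
    exact (ENNReal.ofReal_le_ofReal hst).trans_lt hx

theorem prekopa_leindler_half_real_of_bounded {f g h : ℝ → ℝ≥0∞} (hf : Measurable f)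
    (hg : Measurable g) (hh : Measurable h) (hf₁ : ⨆ x, f x ≠ ∞) (hg₁ : ⨆ x, g x ≠ ∞)
    (H : ∀ x y, f x * g y ≤ h ((2⁻¹ : ℝ) • (x + y)) ^ 2) :
    (∫⁻ x, f x) * ∫⁻ x, g x ≤ (∫⁻ x, h x) ^ 2 := by
  rcases eq_or_ne (⨆ x, f x) 0 with hf₀ | hf₀
  · simp [funext (ENNReal.iSup_eq_zero.1 hf₀)]
  rcases eq_or_ne (⨆ x, g x) 0 with hg₀ | hg₀
  · simp [funext (ENNReal.iSup_eq_zero.1 hg₀)]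
  set a := ⨆ x, f x with ha
  set b := ⨆ x, g x with hb
  obtain ⟨c, hc⟩ : ∃ c : ℝ≥0∞, c ^ 2 = a * b := by
    refine ⟨(a * b) ^ (2⁻¹ : ℝ), ?_⟩
    rw [← ENNReal.rpow_natCast, ← ENNReal.rpow_mul]
    simp
  have hab : (a * b)⁻¹ = a⁻¹ * b⁻¹ := ENNReal.mul_inv (Or.inl hf₀) (Or.inl hf₁)
  have hcinv : (c⁻¹) ^ 2 = a⁻¹ * b⁻¹ := by rw [← ENNReal.inv_pow, hc, hab]
  have key := ENNReal.mul_le_sq_of_add_le_two_mul <| lintegral_add_lintegral_le_of_normalized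
    (hf.const_mul a⁻¹) (hg.const_mul b⁻¹) (hh.const_mul c⁻¹)
    (by rw [← ENNReal.mul_iSup, ← ha, ENNReal.inv_mul_cancel hf₀ hf₁])
    (by rw [← ENNReal.mul_iSup, ← hb, ENNReal.inv_mul_cancel hg₀ hg₁])
    (fun x y => by
      rw [mul_pow, hcinv, mul_mul_mul_comm]
      gcongr
      exact H x y)
  rw [lintegral_const_mul _ hf, lintegral_const_mul _ hg, lintegral_const_mul _ hh, mul_pow, hcinv,
    mul_mul_mul_comm] at key
  exact (ENNReal.mul_le_mul_iff_right
    (mul_ne_zero (ENNReal.inv_ne_zero.2 hf₁) (ENNReal.inv_ne_zero.2 hg₁))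
    (ENNReal.mul_ne_top (ENNReal.inv_ne_top.2 hf₀) (ENNReal.inv_ne_top.2 hg₀))).1 key

theorem lintegral_eq_iSup_lintegral_min_natCast {α : Type*} [MeasurableSpace α] {μ : Measure α}
    {f : α → ℝ≥0∞} (hf : Measurable f) :
    ∫⁻ x, f x ∂μ = ⨆ k : ℕ, ∫⁻ x, min (f x) k ∂μ := by
  rw [← lintegral_iSup (fun k => hf.min measurable_const)
    fun k l hkl x => min_le_min_left _ (by exact_mod_cast hkl)]
  refine lintegral_congr fun x => ?_
  rw [← inf_iSup_eq, ENNReal.iSup_natCast, inf_top_eq]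

theorem prekopa_leindler_half_real {f g h : ℝ → ℝ≥0∞} (hf : Measurable f)
    (hg : Measurable g) (hh : Measurable h)
    (H : ∀ x y, f x * g y ≤ h ((2⁻¹ : ℝ) • (x + y)) ^ 2) :
    (∫⁻ x, f x) * ∫⁻ x, g x ≤ (∫⁻ x, h x) ^ 2 := by
  rw [lintegral_eq_iSup_lintegral_min_natCast hf, lintegral_eq_iSup_lintegral_min_natCast hg,
    ENNReal.iSup_mul]
  refine iSup_le fun k => ?_
  rw [ENNReal.mul_iSup]
  refine iSup_le fun l => ?_
  refine prekopa_leindler_half_real_of_bounded (hf.min measurable_const)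
    (hg.min measurable_const) hh ?_ ?_ fun x y => ?_
  · exact ne_top_of_le_ne_top (ENNReal.natCast_ne_top k) (iSup_le fun x => min_le_right _ _)
  · exact ne_top_of_le_ne_top (ENNReal.natCast_ne_top l) (iSup_le fun x => min_le_right _ _)
  · exact (mul_le_mul' (min_le_left _ _) (min_le_left _ _)).trans (H x y)

theorem lintegral_fin_succ_cons {n : ℕ} {f : (Fin (n + 1) → ℝ) → ℝ≥0∞} (hf : Measurable f) :
    ∫⁻ x, f x = ∫⁻ s : ℝ, ∫⁻ x : Fin n → ℝ, f (Fin.cons s x) := by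
  have e := (volume_preserving_piFinSuccAbove (fun _ : Fin (n + 1) => ℝ) 0).symm
  rw [← e.lintegral_comp hf, Measure.volume_eq_prod,
    lintegral_prod (fun p => f ((MeasurableEquiv.piFinSuccAbove (fun _ => ℝ) 0).symm p))
      (hf.comp (MeasurableEquiv.measurable _)).aemeasurable]
  simp [MeasurableEquiv.piFinSuccAbove, Fin.insertNthEquiv]

/-- The Prékopa–Leindler inequality with weights `1/2, 1/2`. -/
theorem prekopa_leindler_half {n : ℕ} {f g h : (Fin n → ℝ) → ℝ≥0∞} (hf : Measurable f)
    (hg : Measurable g) (hh : Measurable h)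
    (H : ∀ x y, f x * g y ≤ h ((2⁻¹ : ℝ) • (x + y)) ^ 2) :
    (∫⁻ x, f x) * ∫⁻ x, g x ≤ (∫⁻ x, h x) ^ 2 := by
  induction n with
  | zero =>
    rw [Measure.volume_pi_eq_dirac (0 : Fin 0 → ℝ), lintegral_dirac' 0 hf, lintegral_dirac' 0 hg,
      lintegral_dirac' 0 hh]
    simpa only [add_zero, smul_zero] using H 0 0
  | succ n ih =>
    have hcons : Measurable fun p : ℝ × (Fin n → ℝ) => (Fin.cons p.1 p.2 : Fin (n + 1) → ℝ) := by
      refine measurable_pi_iff.2 fun i => ?_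
      refine Fin.cases ?_ (fun i => ?_) i <;> simp only [Fin.cons_zero, Fin.cons_succ] <;> fun_prop
    have hcons' (s : ℝ) : Measurable fun x : Fin n → ℝ => (Fin.cons s x : Fin (n + 1) → ℝ) :=
      hcons.comp measurable_prodMk_left
    rw [lintegral_fin_succ_cons hf, lintegral_fin_succ_cons hg, lintegral_fin_succ_cons hh]
    refine prekopa_leindler_half_real (hf.comp hcons).lintegral_prod_right'
      (hg.comp hcons).lintegral_prod_right' (hh.comp hcons).lintegral_prod_right' fun s t => ?_
    refine ih (hf.comp (hcons' s)) (hg.comp (hcons' t)) (hh.comp (hcons' _)) fun x y => ?_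
    convert H (Fin.cons s x) (Fin.cons t y) using 3
    ext i
    refine Fin.cases ?_ (fun i => ?_) i <;> simp [mul_add]

theorem EuclideanSpace.volume_mul_volume_le {n : ℕ} {A B H : Set (EuclideanSpace ℝ (Fin n))}
    (hA : MeasurableSet A) (hB : MeasurableSet B) (hH : MeasurableSet H)
    (h : ∀ x ∈ A, ∀ y ∈ B, (2⁻¹ : ℝ) • (x + y) ∈ H) :
    volume A * volume B ≤ volume H ^ 2 := by
  have e := PiLp.volume_preserving_toLp (Fin n)
  rw [← e.measure_preimage hA.nullMeasurableSet, ← e.measure_preimage hB.nullMeasurableSet,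
    ← e.measure_preimage hH.nullMeasurableSet]
  have hA' := e.measurable hA
  have hB' := e.measurable hB
  have hH' := e.measurable hH
  rw [← lintegral_indicator_one hA', ← lintegral_indicator_one hB', ← lintegral_indicator_one hH']
  refine prekopa_leindler_half (measurable_one.indicator hA') (measurable_one.indicator hB')
    (measurable_one.indicator hH') fun x y => ?_
  by_cases hx : WithLp.toLp 2 x ∈ A
  · by_cases hy : WithLp.toLp 2 y ∈ B
    · have := h _ hx _ hy
      rw [← WithLp.toLp_add, ← WithLp.toLp_smul] at this
      simp [Set.indicator, Set.mem_preimage, hx, hy, this, -smul_add, -WithLp.toLp_smul,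
        -WithLp.toLp_add]
    · simp [Set.indicator, hy]
  · simp [Set.indicator, hx]

namespace IsSymmConvexBody

variable {E : Type*} [NormedAddCommGroup E] [NormedSpace ℝ E] {K : Set E}

theorem neg_mem (hK : IsSymmConvexBody K) {x : E} (hx : x ∈ K) : -x ∈ K := by
  rw [hK.2.2.2]
  simpa using hx

theorem mem_nhds_zero (hK : IsSymmConvexBody K) : K ∈ nhds (0 : E) := by
  obtain ⟨x, hx⟩ := hK.2.2.1
  have hx' : -x ∈ interior K := by
    refine mem_interior.2 ⟨-interior K, ?_, isOpen_interior.neg, by simpa using hx⟩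
    intro y hy
    simpa using hK.neg_mem (interior_subset hy)
  have := hK.2.1.interior.midpoint_mem hx hx'
  rw [midpoint_self_neg] at this
  exact mem_interior_iff_mem_nhds.1 this

theorem gauge_le_one_iff (hK : IsSymmConvexBody K) {x : E} : gauge K x ≤ 1 ↔ x ∈ K := by
  rw [gauge_le_one_iff_mem_closure hK.2.1 hK.mem_nhds_zero, hK.1.isClosed.closure_eq]

theorem mem_smul_of_gauge_le (hK : IsSymmConvexBody K) {x : E} {r : ℝ} (hr : 0 < r)
    (h : gauge K x ≤ r) : x ∈ r • K := by
  rw [Set.mem_smul_set_iff_inv_smul_mem₀ hr.ne', ← hK.gauge_le_one_iff,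
    gauge_smul_of_nonneg (inv_nonneg.2 hr.le), smul_eq_mul]
  exact inv_mul_le_one_of_le₀ h hr.le

theorem gauge_midpoint_le (hK : IsSymmConvexBody K) {α ε : ℝ} (hα : IsTwoConvex K α)
    (hε : 0 < ε) (hε₂ : ε ≤ 2) {x y : E} (hx : x ∈ K) (hy : y ∈ K) (hxy : ε ≤ gauge K (x - y)) :
    gauge K ((2⁻¹ : ℝ) • (x + y)) ≤ 1 - α * ε ^ 2 := by
  have hle : modulusOfConvexity K ε ≤ 1 - gauge K ((2⁻¹ : ℝ) • (x + y)) := by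
    refine csInf_le ⟨0, ?_⟩ ⟨x, y, hK.gauge_le_one_iff.2 hx, hK.gauge_le_one_iff.2 hy, hxy, rfl⟩
    rintro _ ⟨u, v, hu, hv, -, rfl⟩
    have := hK.2.1 (hK.gauge_le_one_iff.1 hu) (hK.gauge_le_one_iff.1 hv)
      (by norm_num : (0 : ℝ) ≤ 2⁻¹) (by norm_num : (0 : ℝ) ≤ 2⁻¹) (by norm_num)
    rw [← smul_add] at this
    exact sub_nonneg.2 (hK.gauge_le_one_iff.2 this)
  linarith [hα ε hε hε₂]

end IsSymmConvexBody

section EuclideanSpace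

variable {n : ℕ} {K : Set (EuclideanSpace ℝ (Fin n))}

theorem IsSymmConvexBody.inner_le_mul_gauge (hK : IsSymmConvexBody K)
    {θ : EuclideanSpace ℝ (Fin n)} {r : ℝ} (hr : 0 < r) (hθ : ∀ x ∈ K, ⟪x, θ⟫ ≤ r)
    (x : EuclideanSpace ℝ (Fin n)) : ⟪x, θ⟫ ≤ r * gauge K x := by
  rw [mul_comm, ← div_le_iff₀ hr]
  refine le_of_forall_gt_imp_ge_of_dense fun a ha => ?_
  obtain ⟨b, hb, hba, y, hy, rfl⟩ :=
    exists_lt_of_gauge_lt (absorbent_nhds_zero hK.mem_nhds_zero) ha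
  rw [div_le_iff₀ hr]
  simp only [real_inner_smul_left]
  exact (mul_le_mul_of_nonneg_left (hθ y hy) hb.le).trans (mul_le_mul_of_nonneg_right hba.le hr.le)

theorem one_lt_volume_closedBall_sqrt (hn : 0 < n) :
    1 < volume (Metric.closedBall (0 : EuclideanSpace ℝ (Fin n)) (Real.sqrt n)) := by
  rw [← (PiLp.volume_preserving_toLp (Fin n)).measure_preimage
    measurableSet_closedBall.nullMeasurableSet]
  have hsub : Set.Icc (fun _ : Fin n => (-1 : ℝ)) (fun _ => 1) ⊆
      WithLp.toLp 2 ⁻¹' Metric.closedBall (0 : EuclideanSpace ℝ (Fin n)) (Real.sqrt n) := by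
    intro x hx
    rw [Set.mem_preimage, mem_closedBall_zero_iff, EuclideanSpace.norm_eq]
    refine Real.sqrt_le_sqrt ?_
    calc ∑ i, ‖x i‖ ^ 2 ≤ ∑ _i : Fin n, (1 : ℝ) := by
          refine Finset.sum_le_sum fun i _ => ?_
          rw [Real.norm_eq_abs, sq_abs]
          nlinarith [hx.1 i, hx.2 i]
      _ = n := by simp
  refine lt_of_lt_of_le ?_ (measure_mono hsub)
  rw [Real.volume_Icc_pi]
  norm_num
  exact one_lt_pow₀ (by norm_num) hn.ne'

theorem IsSymmConvexBody.exists_unit_inner_le_sqrt (hn : 0 < n) (hK : IsSymmConvexBody K)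
    (hvol : volume K ≤ 1) :
    ∃ θ : EuclideanSpace ℝ (Fin n), ‖θ‖ = 1 ∧ ∀ x ∈ K, ⟪x, θ⟫ ≤ Real.sqrt n := by
  by_contra! hcon
  refine (one_lt_volume_closedBall_sqrt hn).not_ge ((measure_mono ?_).trans hvol)
  intro z hz
  by_contra hzK
  obtain ⟨f, u, hfu, huz⟩ := geometric_hahn_banach_closed_point hK.2.1 hK.1.isClosed hzK
  obtain ⟨w, rfl⟩ := (InnerProductSpace.toDual ℝ (EuclideanSpace ℝ (Fin n))).surjective f
  simp only [InnerProductSpace.toDual_apply_apply] at hfu huz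
  have hu : 0 < u := by simpa using hfu 0 (mem_of_mem_nhds hK.mem_nhds_zero)
  have hw : w ≠ 0 := by
    rintro rfl
    simp only [inner_zero_left] at huz
    linarith
  have hw' : 0 < ‖w‖ := norm_pos_iff.2 hw
  obtain ⟨x, hx, hlt⟩ := hcon (‖w‖⁻¹ • w) (norm_smul_inv_norm hw)
  rw [real_inner_smul_right, real_inner_comm, ← div_eq_inv_mul, lt_div_iff₀ hw'] at hlt
  have h₁ := hfu x hx
  have h₂ := real_inner_le_norm w z
  have h₃ : ‖z‖ ≤ Real.sqrt n := by simpa using hz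
  nlinarith

theorem IsSymmConvexBody.volume_inner_ge_le (hK : IsSymmConvexBody K) (hvol : volume K = 1)
    {α : ℝ} (hα : IsTwoConvex K α) (hn : 0 < n) {θ : EuclideanSpace ℝ (Fin n)}
    (hθ : ∀ x ∈ K, ⟪x, θ⟫ ≤ Real.sqrt n) {t : ℝ} (ht : 0 < t) :
    volume {x ∈ K | t ≤ ⟪x, θ⟫} ≤ ENNReal.ofReal (Real.exp (-(4 * α * t ^ 2))) := by
  set A := {x ∈ K | t ≤ ⟪x, θ⟫}
  have hn' : (0 : ℝ) < n := by exact_mod_cast hn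
  have hsn : 0 < Real.sqrt n := Real.sqrt_pos.2 hn'
  have hAm : MeasurableSet A :=
    hK.1.isClosed.measurableSet.inter (measurableSet_le measurable_const
      (by fun_prop : Measurable fun x : EuclideanSpace ℝ (Fin n) => ⟪x, θ⟫))
  set s := Real.exp (-(4 * α * t ^ 2 / n))
  have hsub : ∀ x ∈ A, ∀ y ∈ -A, (2⁻¹ : ℝ) • (x + y) ∈ s • K := by
    intro x hx y hy
    have hyK : y ∈ K := by simpa using hK.neg_mem hy.1
    have hyt : t ≤ -⟪y, θ⟫ := by simpa [inner_neg_left] using hy.2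
    have hxt := hx.2
    have hts : t ≤ Real.sqrt n := hxt.trans (hθ x hx.1)
    refine hK.mem_smul_of_gauge_le (Real.exp_pos _) ?_
    have hle := hK.gauge_midpoint_le hα (ε := 2 * t / Real.sqrt n) (by positivity)
      (by rw [div_le_iff₀ hsn]; linarith) hx.1 hyK (by
        rw [div_le_iff₀ hsn, mul_comm (gauge _ _)]
        refine le_trans ?_ (hK.inner_le_mul_gauge hsn hθ _)
        rw [inner_sub_left]
        linarith)
    have hexp := Real.add_one_le_exp (-(4 * α * t ^ 2 / n))
    have heq : α * (2 * t / Real.sqrt n) ^ 2 = 4 * α * t ^ 2 / n := by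
      rw [div_pow, Real.sq_sqrt hn'.le]
      ring
    rw [heq] at hle
    linarith
  have key := EuclideanSpace.volume_mul_volume_le hAm hAm.neg
    (hK.1.smul s).isClosed.measurableSet hsub
  have hvs : volume (s • K) = ENNReal.ofReal (Real.exp (-(4 * α * t ^ 2))) := by
    rw [Measure.addHaar_smul, hvol, mul_one, finrank_euclideanSpace_fin,
      abs_of_pos (pow_pos (Real.exp_pos _) _), ← Real.exp_nat_mul]
    congr 2
    field_simp
  rw [Measure.measure_neg, ← sq, hvs] at key
  exact le_of_not_gt fun hlt => key.not_gt (ENNReal.pow_lt_pow_left two_ne_zero hlt)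

theorem IsSymmConvexBody.volume_sq_inner_ge_le (hK : IsSymmConvexBody K) (hvol : volume K = 1)
    {α : ℝ} (hα₀ : 0 < α) (hα : IsTwoConvex K α) (hn : 0 < n) {θ : EuclideanSpace ℝ (Fin n)}
    (hθ : ∀ x ∈ K, ⟪x, θ⟫ ≤ Real.sqrt n) {v : ℝ} (hv : 0 < v) :
    volume.restrict K {x | v ≤ α * ⟪x, θ⟫ ^ 2} ≤ ENNReal.ofReal (2 * Real.exp (-(4 * v))) := by
  set t := Real.sqrt (v / α) with ht
  have ht₀ : 0 < t := Real.sqrt_pos.2 (by positivity)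
  have ht₂ : α * t ^ 2 = v := by
    rw [ht, Real.sq_sqrt (by positivity)]
    field_simp
  rw [Measure.restrict_apply' hK.1.isClosed.measurableSet]
  have hsub : {x | v ≤ α * ⟪x, θ⟫ ^ 2} ∩ K ⊆
      {x ∈ K | t ≤ ⟪x, θ⟫} ∪ -{x ∈ K | t ≤ ⟪x, θ⟫} := by
    rintro x ⟨hx, hxK⟩
    have hsq : t ^ 2 ≤ ⟪x, θ⟫ ^ 2 := by
      rw [Set.mem_ofPred_eq, ← ht₂] at hx
      exact le_of_mul_le_mul_left hx hα₀
    rcases le_abs.1 ((abs_of_pos ht₀).symm.le.trans (sq_le_sq.1 hsq)) with h | h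
    · exact Or.inl ⟨hxK, h⟩
    · exact Or.inr ⟨hK.neg_mem hxK, by rwa [inner_neg_left]⟩
  have hle := hK.volume_inner_ge_le hvol hα hn hθ ht₀
  rw [show 4 * α * t ^ 2 = 4 * v by rw [← ht₂]; ring] at hle
  calc _ ≤ volume {x ∈ K | t ≤ ⟪x, θ⟫} + volume (-{x ∈ K | t ≤ ⟪x, θ⟫}) :=
        (measure_mono hsub).trans (measure_union_le _ _)
    _ ≤ _ := by
        rw [Measure.measure_neg, ← two_mul, ENNReal.ofReal_mul zero_le_two, ENNReal.ofReal_ofNat]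
        gcongr

theorem lintegral_exp_sub_one_le {Ω : Type*} [MeasurableSpace Ω] {μ : Measure Ω} {X : Ω → ℝ}
    (hX : Measurable X) (hX₀ : ∀ ω, 0 ≤ X ω)
    (htail : ∀ v > 0, μ {ω | v ≤ X ω} ≤ ENNReal.ofReal (2 * Real.exp (-(4 * v)))) :
    ∫⁻ ω, ENNReal.ofReal (Real.exp (X ω) - 1) ∂μ ≤ 1 := by
  have hcake := lintegral_comp_eq_lintegral_meas_le_mul (g := Real.exp) μ
    (Filter.Eventually.of_forall hX₀) hX.aemeasurable
    (fun t _ => Real.continuous_exp.intervalIntegrable 0 t)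
    (Filter.Eventually.of_forall fun t => (Real.exp_pos t).le)
  simp only [integral_exp, Real.exp_zero] at hcake
  rw [hcake]
  have hint : IntegrableOn (fun v : ℝ => 2 * Real.exp (-3 * v)) (Set.Ioi 0) :=
    (integrableOn_exp_mul_Ioi (by norm_num) 0).const_mul 2
  calc ∫⁻ v in Set.Ioi 0, μ {ω | v ≤ X ω} * ENNReal.ofReal (Real.exp v)
      ≤ ∫⁻ v in Set.Ioi (0 : ℝ), ENNReal.ofReal (2 * Real.exp (-3 * v)) := by
        refine setLIntegral_mono' measurableSet_Ioi fun v hv => ?_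
        refine (mul_le_mul_left (htail v hv) _).trans_eq ?_
        rw [← ENNReal.ofReal_mul (by positivity), mul_assoc, ← Real.exp_add]
        ring_nf
    _ = ENNReal.ofReal (∫ v in Set.Ioi (0 : ℝ), 2 * Real.exp (-3 * v)) :=
        (ofReal_integral_eq_lintegral_ofReal hint
          (Filter.Eventually.of_forall fun v => by positivity)).symm
    _ ≤ 1 := by
        rw [integral_const_mul, integral_exp_mul_Ioi (by norm_num)]
        norm_num

theorem IsSymmConvexBody.setIntegral_exp_le_two (hK : IsSymmConvexBody K) (hvol : volume K = 1)
    {α : ℝ} (hα₀ : 0 < α) (hα : IsTwoConvex K α) (hn : 0 < n) {θ : EuclideanSpace ℝ (Fin n)}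
    (hθ : ∀ x ∈ K, ⟪x, θ⟫ ≤ Real.sqrt n) :
    ∫ x in K, Real.exp (α * ⟪x, θ⟫ ^ 2) ≤ 2 := by
  have hX : Measurable fun x : EuclideanSpace ℝ (Fin n) => α * ⟪x, θ⟫ ^ 2 := by fun_prop
  have hle := lintegral_exp_sub_one_le (μ := volume.restrict K) hX (fun x => by positivity)
    fun v hv => hK.volume_sq_inner_ge_le hvol hα₀ hα hn hθ hv
  rw [integral_eq_lintegral_of_nonneg_ae (Filter.Eventually.of_forall fun x => (Real.exp_pos _).le)
    hX.exp.aestronglyMeasurable]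
  refine ENNReal.toReal_le_of_le_ofReal zero_le_two ?_
  calc ∫⁻ x in K, ENNReal.ofReal (Real.exp (α * ⟪x, θ⟫ ^ 2))
      = ∫⁻ x in K, (ENNReal.ofReal (Real.exp (α * ⟪x, θ⟫ ^ 2) - 1) + 1) := by
        refine lintegral_congr fun x => ?_
        rw [← ENNReal.ofReal_one, ← ENNReal.ofReal_add
          (sub_nonneg.2 (Real.one_le_exp (by positivity))) zero_le_one, sub_add_cancel]
    _ = (∫⁻ x in K, ENNReal.ofReal (Real.exp (α * ⟪x, θ⟫ ^ 2) - 1)) + 1 := by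
        rw [lintegral_add_right _ measurable_const, setLIntegral_one, hvol]
    _ ≤ 1 + 1 := by gcongr
    _ = ENNReal.ofReal 2 := by norm_num

end EuclideanSpace

theorem twoConvex_exists_psiTwo_direction :
    ∃ C : ℝ, 0 < C ∧ ∀ (n : ℕ) (K : Set (EuclideanSpace ℝ (Fin n))) (α : ℝ),
      0 < n → IsSymmConvexBody K → volume K = 1 → 0 < α → IsTwoConvex K α →
      ∃ θ : EuclideanSpace ℝ (Fin n), ‖θ‖ = 1 ∧
        psiTwoNorm K θ ≤ C / Real.sqrt α := by
  refine ⟨1, one_pos, fun n K α hn hK hvol hα₀ hα => ?_⟩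
  obtain ⟨θ, hθ₁, hθ⟩ := hK.exists_unit_inner_le_sqrt hn hvol.le
  refine ⟨θ, hθ₁, csInf_le ⟨0, fun l hl => hl.1.le⟩ ⟨by positivity, ?_⟩⟩
  rw [hvol, ENNReal.toReal_one, inv_one, one_mul]
  convert hK.setIntegral_exp_le_two hvol hα₀ hα hn hθ using 4 with x
  rw [div_pow, Real.sq_sqrt hα₀.le]
  field_simp
end
end

section
/- There exists a universal constant C > 0 with the following property. Let K ⊂ ℝⁿ be a centrally symmetric convex body which is 2-smooth with constant β > 0. Then there exists an ellipsoid E (an invertible linear image of the Euclidean unit ball D_n) with K ⊆ E and (|E|/|K|)^{1/n} ≤ C·√β; that is, the outer-volume-ratio of K is at most C·√β. -/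
open MeasureTheory
open scoped RealInnerProductSpace

noncomputable section

/-- The modulus of smoothness of `K`, defined via the gauge of `K`. -/
def modulusOfSmoothness {E : Type*} [AddCommGroup E] [Module ℝ E]
    (K : Set E) (τ : ℝ) : ℝ :=
  sSup { d | ∃ x y : E, gauge K x ≤ 1 ∧ gauge K y ≤ τ ∧
    d = (gauge K (x + y) + gauge K (x - y)) / 2 - 1 }

/-- `K` is 2-smooth with constant `β`: `ρ_K(τ) ≤ β τ²` for all `τ > 0`. -/
def IsTwoSmooth {E : Type*} [AddCommGroup E] [Module ℝ E]
    (K : Set E) (β : ℝ) : Prop :=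
  ∀ τ : ℝ, 0 < τ → modulusOfSmoothness K τ ≤ β * τ ^ 2

/-- An ellipsoid: the image of the Euclidean unit ball under an invertible linear map. -/
def IsEllipsoid {n : ℕ} (A : Set (EuclideanSpace ℝ (Fin n))) : Prop :=
  ∃ T : EuclideanSpace ℝ (Fin n) ≃ₗ[ℝ] EuclideanSpace ℝ (Fin n),
    A = T '' Metric.closedBall 0 1

/-- `K` is in John's maximal-volume ellipsoid position: some Euclidean ball `r·D_n ⊆ K`
has maximal volume among all ellipsoids contained in `K`. -/
def InJohnPosition {n : ℕ} (K : Set (EuclideanSpace ℝ (Fin n))) : Prop :=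
  ∃ r : ℝ, 0 < r ∧ Metric.closedBall (0 : EuclideanSpace ℝ (Fin n)) r ⊆ K ∧
    ∀ A : Set (EuclideanSpace ℝ (Fin n)), IsEllipsoid A → A ⊆ K →
      volume A ≤ volume (Metric.closedBall (0 : EuclideanSpace ℝ (Fin n)) r)

/-- `K` is in Löwner's minimal-volume outer ellipsoid position: some Euclidean ball
`R·D_n ⊇ K` has minimal volume among all ellipsoids containing `K`. -/
def InLownerPosition {n : ℕ} (K : Set (EuclideanSpace ℝ (Fin n))) : Prop :=
  ∃ R : ℝ, 0 < R ∧ K ⊆ Metric.closedBall (0 : EuclideanSpace ℝ (Fin n)) R ∧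
    ∀ A : Set (EuclideanSpace ℝ (Fin n)), IsEllipsoid A → K ⊆ A →
      volume (Metric.closedBall (0 : EuclideanSpace ℝ (Fin n)) R) ≤ volume A

theorem IsSymmConvexBody.mem_nhds_zero_s11 {E : Type*} [NormedAddCommGroup E] [NormedSpace ℝ E]
    {K : Set E} (hK : IsSymmConvexBody K) : K ∈ nhds (0 : E) := by
  obtain ⟨-, hconv, ⟨x, hx⟩, hsymm⟩ := hK
  have hx' : -x ∈ interior K := by
    have h : (Homeomorph.neg E) ⁻¹' interior K = interior K := by
      rw [Homeomorph.preimage_interior]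
      exact congrArg interior hsymm.symm
    rwa [← h] at hx
  have h0 := hconv.interior hx hx' (by norm_num : (0 : ℝ) ≤ 1 / 2)
    (by norm_num : (0 : ℝ) ≤ 1 / 2) (by norm_num)
  rw [smul_neg, add_neg_cancel] at h0
  exact mem_interior_iff_mem_nhds.1 h0

theorem gauge_add_le_of_isTwoSmooth {E : Type*} [NormedAddCommGroup E] [NormedSpace ℝ E]
    {K : Set E} (hK : IsSymmConvexBody K) {β : ℝ} (h : IsTwoSmooth K β) {τ : ℝ} (hτ : 0 < τ)
    {x y : E} (hx : gauge K x ≤ 1) (hy : gauge K y ≤ τ) :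
    (gauge K (x + y) + gauge K (x - y)) / 2 - 1 ≤ β * τ ^ 2 := by
  have hab : Absorbent ℝ K := absorbent_nhds_zero hK.mem_nhds_zero_s11
  have hneg : ∀ x ∈ K, -x ∈ K := fun x hx => by rw [hK.2.2.2] at hx; exact hx
  have hbdd : BddAbove {d | ∃ x y : E, gauge K x ≤ 1 ∧ gauge K y ≤ τ ∧
      d = (gauge K (x + y) + gauge K (x - y)) / 2 - 1} := by
    refine ⟨τ, ?_⟩
    rintro d ⟨u, v, hu, hv, rfl⟩
    have h1 := gauge_add_le hK.2.1 hab u v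
    have h2 := gauge_add_le hK.2.1 hab u (-v)
    rw [gauge_neg hneg, ← sub_eq_add_neg] at h2
    linarith
  exact (le_csSup hbdd ⟨x, y, hx, hy, rfl⟩).trans (h τ hτ)

theorem sq_gauge_add_le_of_isTwoSmooth {E : Type*} [NormedAddCommGroup E] [NormedSpace ℝ E]
    [Nontrivial E] {K : Set E} (hK : IsSymmConvexBody K) {β : ℝ} (h : IsTwoSmooth K β) (x y : E) :
    gauge K (x + y) ^ 2 + gauge K (x - y) ^ 2 ≤ 2 * gauge K x ^ 2 + 20 * β * gauge K y ^ 2 := by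
  have hab : Absorbent ℝ K := absorbent_nhds_zero hK.mem_nhds_zero_s11
  have hbd : Bornology.IsVonNBounded ℝ K := NormedSpace.isVonNBounded_of_isBounded ℝ hK.1.isBounded
  have hneg : ∀ x ∈ K, -x ∈ K := fun x hx => by rw [hK.2.2.2] at hx; exact hx
  have hsm : ∀ (c : ℝ) (z : E), 0 ≤ c → gauge K (c • z) = c * gauge K z := fun c z hc => by
    rw [gauge_smul_of_nonneg hc, smul_eq_mul]
  have hpos : ∀ {z : E}, z ≠ 0 → 0 < gauge K z := fun hz => (gauge_pos hab hbd).2 hz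
  have hβ : 1 / 4 ≤ β := by
    obtain ⟨z, hz⟩ := exists_ne (0 : E)
    set u := (gauge K z)⁻¹ • z with hu
    have hu1 : gauge K u = 1 := by
      rw [hu, hsm _ _ (inv_nonneg.2 (gauge_nonneg _)), inv_mul_cancel₀ (hpos hz).ne']
    have h2 : gauge K ((2 : ℝ) • u) = 2 := by rw [hsm _ _ (by norm_num), hu1, mul_one]
    have := gauge_add_le_of_isTwoSmooth hK h two_pos hu1.le h2.le
    rw [show u + (2 : ℝ) • u = (3 : ℝ) • u by module, show u - (2 : ℝ) • u = -u by module,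
      gauge_neg hneg, hsm _ _ (by norm_num), hu1] at this
    linarith
  rcases eq_or_ne x 0 with rfl | hx
  · simp only [zero_add, zero_sub, gauge_neg hneg, gauge_zero]
    nlinarith [sq_nonneg (gauge K y)]
  rcases eq_or_ne y 0 with rfl | hy
  · simp only [add_zero, sub_zero, gauge_zero]
    linarith
  have hr := hpos hx
  have hq := hpos hy
  set r := gauge K x with hrdef
  set q := gauge K y with hqdef
  have key := gauge_add_le_of_isTwoSmooth hK h (div_pos hq hr) (x := r⁻¹ • x) (y := r⁻¹ • y)
    (by rw [hsm _ _ (inv_nonneg.2 hr.le), ← hrdef, inv_mul_cancel₀ hr.ne'])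
    (by rw [hsm _ _ (inv_nonneg.2 hr.le), ← hqdef, div_eq_inv_mul])
  rw [← smul_add, ← smul_sub, hsm _ _ (inv_nonneg.2 hr.le), hsm _ _ (inv_nonneg.2 hr.le)] at key
  have h1 : gauge K (x + y) ≤ r + q := gauge_add_le hK.2.1 hab x y
  have h2 : gauge K (x - y) ≤ r + q := by
    have := gauge_add_le hK.2.1 hab x (-y)
    rwa [gauge_neg hneg, ← sub_eq_add_neg] at this
  have h3 : gauge K (x + y) - gauge K (x - y) ≤ 2 * q := by
    have := gauge_add_le hK.2.1 hab (x - y) ((2 : ℝ) • y)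
    rw [hsm _ _ (by norm_num), show x - y + (2 : ℝ) • y = x + y by module] at this
    linarith
  have h4 : gauge K (x - y) - gauge K (x + y) ≤ 2 * q := by
    have := gauge_add_le hK.2.1 hab (x + y) ((2 : ℝ) • -y)
    rw [hsm _ _ (by norm_num), gauge_neg hneg,
      show x + y + (2 : ℝ) • -y = x - y by module] at this
    linarith
  have ha0 := gauge_nonneg (s := K) (x + y)
  have hb0 := gauge_nonneg (s := K) (x - y)
  generalize gauge K (x + y) = a at *
  generalize gauge K (x - y) = b at *
  have key' : r * ((a + b) / 2) ≤ r ^ 2 + β * q ^ 2 := by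
    have : r ^ 2 * ((r⁻¹ * a + r⁻¹ * b) / 2 - 1) ≤ r ^ 2 * (β * (q / r) ^ 2) := by gcongr
    have e1 : r ^ 2 * ((r⁻¹ * a + r⁻¹ * b) / 2 - 1) = r * ((a + b) / 2) - r ^ 2 := by
      field_simp
    have e2 : r ^ 2 * (β * (q / r) ^ 2) = β * q ^ 2 := by field_simp
    linarith
  have hd : ((a - b) / 2) ^ 2 ≤ q ^ 2 := sq_le_sq' (by linarith) (by linarith)
  have hm : ((a + b) / 2) ^ 2 ≤ r ^ 2 + 2 * β * q ^ 2 + q ^ 2 := by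
    obtain ⟨e, he⟩ : ∃ e, (a + b) / 2 = r + e := ⟨(a + b) / 2 - r, by ring⟩
    rw [he] at key' ⊢
    rcases le_total e 0 with h0 | h0
    · have : (r + e) ^ 2 ≤ r ^ 2 := sq_le_sq' (by linarith) (by linarith)
      nlinarith [sq_nonneg q]
    · have : e ^ 2 ≤ q ^ 2 := sq_le_sq' (by linarith) (by linarith)
      nlinarith
  have : q ^ 2 ≤ 4 * β * q ^ 2 := by nlinarith [sq_nonneg q]
  nlinarith

theorem exists_equiv_det_maximal {E : Type*} [NormedAddCommGroup E] [NormedSpace ℝ E]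
    [FiniteDimensional ℝ E] {K : Set E} (hb : Bornology.IsBounded K) (h0 : K ∈ nhds (0 : E)) :
    ∃ T : E ≃L[ℝ] E, (∀ x ∈ K, ‖T x‖ ≤ 1) ∧
      ∀ B : E →L[ℝ] E, (∀ x ∈ K, ‖B x‖ ≤ 1) → |B.det| ≤ |(T : E →L[ℝ] E).det| := by
  set S : Set (E →L[ℝ] E) := {B | ∀ x ∈ K, ‖B x‖ ≤ 1} with hS
  have hclosed : IsClosed S := by
    rw [hS, Set.ofPred_forall]
    refine isClosed_iInter fun x => ?_
    rw [Set.ofPred_forall]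
    refine isClosed_iInter fun _ => ?_
    exact isClosed_le (by fun_prop) continuous_const
  obtain ⟨r, hr, hrK⟩ := Metric.mem_nhds_iff.1 h0
  have hbdd : Bornology.IsBounded S := by
    rw [isBounded_iff_forall_norm_le]
    refine ⟨2 / r, fun B hB => B.opNorm_le_bound (by positivity) fun x => ?_⟩
    rcases eq_or_ne x 0 with rfl | hx
    · simp
    have hx' : 0 < ‖x‖ := norm_pos_iff.2 hx
    have hmem : (r / 2 / ‖x‖) • x ∈ K := by
      apply hrK
      rw [mem_ball_zero_iff, norm_smul, Real.norm_of_nonneg (by positivity),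
        div_mul_cancel₀ _ hx'.ne']
      linarith
    have := hB _ hmem
    rw [map_smul, norm_smul, Real.norm_of_nonneg (by positivity)] at this
    calc ‖B x‖ = 2 / r * ‖x‖ * (r / 2 / ‖x‖ * ‖B x‖) := by field_simp
      _ ≤ 2 / r * ‖x‖ * 1 := by gcongr
      _ = _ := mul_one _
  have : ProperSpace (E →L[ℝ] E) := FiniteDimensional.proper ℝ _
  have hcomp : IsCompact S := Metric.isCompact_of_isClosed_isBounded hclosed hbdd
  obtain ⟨R, hR, hRK⟩ := hb.exists_pos_norm_le
  have hne : R⁻¹ • ContinuousLinearMap.id ℝ E ∈ S := by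
    intro x hx
    rw [_root_.smul_apply, norm_smul, ContinuousLinearMap.id_apply,
      Real.norm_of_nonneg (by positivity), inv_mul_le_iff₀ hR, mul_one]
    exact hRK x hx
  obtain ⟨B, hB, hmax⟩ := hcomp.exists_isMaxOn ⟨_, hne⟩
    (ContinuousLinearMap.continuous_det.abs.continuousOn)
  have hdet : B.det ≠ 0 := by
    have h1 : |(R⁻¹ • ContinuousLinearMap.id ℝ E).det| ≤ |B.det| := hmax hne
    have h2 : (R⁻¹ • ContinuousLinearMap.id ℝ E).det = R⁻¹ ^ Module.finrank ℝ E := by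
      simp [ContinuousLinearMap.det, LinearMap.det_smul]
    rw [h2] at h1
    have : (0 : ℝ) < R⁻¹ ^ Module.finrank ℝ E := by positivity
    exact abs_pos.1 (lt_of_lt_of_le (abs_pos.2 this.ne') h1)
  refine ⟨B.toContinuousLinearEquivOfDetNeZero hdet, hB, fun B' hB' => ?_⟩
  exact hmax hB'

theorem hasDerivAt_det_one_add_smul {E : Type*} [AddCommGroup E] [Module ℝ E]
    [FiniteDimensional ℝ E] (B : E →ₗ[ℝ] E) :
    HasDerivAt (fun t : ℝ => LinearMap.det (1 + t • B)) (LinearMap.trace ℝ E B) 0 := by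
  let b := Module.finBasis ℝ E
  set M := LinearMap.toMatrix b b B with hM
  set P : Polynomial ℝ :=
    (1 + (Polynomial.X : Polynomial ℝ) • M.map ⇑Polynomial.C).det.divX.divX with hP
  have h : (fun t : ℝ => LinearMap.det (1 + t • B)) =
      fun t => 1 + M.trace * t + P.eval t * t ^ 2 := by
    ext t
    rw [← LinearMap.det_toMatrix b, map_add, map_smul, LinearMap.toMatrix_one,
      Matrix.det_one_add_smul]
  rw [h, LinearMap.trace_eq_matrix_trace ℝ b, ← hM]
  have h1 := ((hasDerivAt_id (0 : ℝ)).const_mul M.trace).const_add 1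
  have h2 := (P.hasDerivAt 0).mul (hasDerivAt_pow 2 (0 : ℝ))
  exact (h1.add h2).congr_deriv (by simp)

theorem trace_le_finrank_of_det_maximal {E : Type*} [NormedAddCommGroup E] [InnerProductSpace ℝ E]
    [FiniteDimensional ℝ E] {K : Set E} {T : E ≃L[ℝ] E} (hT : ∀ x ∈ K, ‖T x‖ ≤ 1)
    (hmax : ∀ B : E →L[ℝ] E, (∀ x ∈ K, ‖B x‖ ≤ 1) → |B.det| ≤ |(T : E →L[ℝ] E).det|)
    {A : E →L[ℝ] E} (hA : ∀ x ∈ K, ⟪A (T x), T x⟫ ≤ 1) :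
    LinearMap.trace ℝ E A ≤ Module.finrank ℝ E := by
  set B : E →L[ℝ] E := (2 : ℝ)⁻¹ • (A - 1) with hB
  set d := Module.finrank ℝ E
  have hdet : ∀ t : ℝ, 0 ≤ t → t ≤ 1 →
      LinearMap.det (1 + t • (B : E →ₗ[ℝ] E)) ≤ (1 + t ^ 2 * ‖B‖ ^ 2) ^ d := by
    intro t ht0 ht1
    set c : ℝ := (1 + t ^ 2 * ‖B‖ ^ 2)⁻¹ with hc
    have hc0 : 0 < c := by positivity
    have hc1 : c ≤ 1 :=
      inv_le_one_of_one_le₀ (by nlinarith [mul_nonneg (sq_nonneg t) (sq_nonneg ‖B‖)])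
    have hadm : ∀ x ∈ K, ‖(c • ((1 + t • B) ∘L (T : E →L[ℝ] E))) x‖ ≤ 1 := by
      intro x hx
      set u := T x with hu
      have hu1 : ‖u‖ ≤ 1 := hT x hx
      have hval : (c • ((1 + t • B) ∘L (T : E →L[ℝ] E))) x = c • (u + t • B u) := by
        simp [hu]
      have hBu : ⟪u, B u⟫ = (⟪A u, u⟫ - ‖u‖ ^ 2) / 2 := by
        simp only [hB, _root_.smul_apply, _root_.sub_apply,
          one_apply_eq_self, inner_smul_right, inner_sub_right,
          real_inner_self_eq_norm_sq, real_inner_comm]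
        ring
      have hBn : ‖B u‖ ^ 2 ≤ ‖B‖ ^ 2 := by
        have : ‖B u‖ ≤ ‖B‖ := (B.le_opNorm u).trans (mul_le_of_le_one_right (norm_nonneg _) hu1)
        gcongr
      have hsq : ‖u + t • B u‖ ^ 2 ≤ 1 + t ^ 2 * ‖B‖ ^ 2 := by
        rw [norm_add_sq_real, inner_smul_right, hBu, norm_smul, mul_pow, Real.norm_eq_abs, sq_abs]
        have h1 := hA x hx
        have h2 : ‖u‖ ^ 2 ≤ 1 := pow_le_one₀ (norm_nonneg _) hu1
        nlinarith [mul_le_mul_of_nonneg_left hBn (sq_nonneg t), mul_le_mul_of_nonneg_left h1 ht0,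
          mul_le_mul_of_nonneg_left h2 (sub_nonneg.2 ht1)]
      rw [hval, norm_smul, Real.norm_of_nonneg hc0.le]
      refine (sq_le_one_iff₀ (by positivity)).1 ?_
      rw [mul_pow]
      calc c ^ 2 * ‖u + t • B u‖ ^ 2 ≤ c ^ 2 * (1 + t ^ 2 * ‖B‖ ^ 2) := by gcongr
        _ = c := by rw [hc]; field_simp
        _ ≤ 1 := hc1
    have h1 := hmax _ hadm
    have h2 : (c • ((1 + t • B) ∘L (T : E →L[ℝ] E))).det =
        c ^ d * (LinearMap.det (1 + t • (B : E →ₗ[ℝ] E)) * (T : E →L[ℝ] E).det) := by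
      simp only [ContinuousLinearMap.det, ContinuousLinearMap.toLinearMap_smul, LinearMap.det_smul,
        ContinuousLinearMap.toLinearMap_comp, LinearMap.det_comp]
      rfl
    have hTdet : 0 < |(T : E →L[ℝ] E).det| :=
      abs_pos.2 (LinearEquiv.isUnit_det' T.toLinearEquiv).ne_zero
    rw [h2, abs_mul, abs_mul, ← mul_assoc, abs_of_pos (pow_pos hc0 d)] at h1
    have h3 : c ^ d * |LinearMap.det (1 + t • (B : E →ₗ[ℝ] E))| ≤ 1 :=
      le_of_mul_le_mul_right (by rwa [one_mul]) hTdet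
    refine (le_abs_self _).trans ?_
    rw [hc, inv_pow] at h3
    rwa [inv_mul_le_iff₀ (by positivity), mul_one] at h3
  have hder : HasDerivAt (fun t : ℝ => LinearMap.det (1 + t • (B : E →ₗ[ℝ] E)) -
      (1 + t ^ 2 * ‖B‖ ^ 2) ^ d) (LinearMap.trace ℝ E B) 0 := by
    have h2 := ((((hasDerivAt_pow 2 (0 : ℝ)).mul_const (‖B‖ ^ 2)).const_add 1).pow d)
    exact ((hasDerivAt_det_one_add_smul (B : E →ₗ[ℝ] E)).sub h2).congr_deriv (by simp)
  have htr : LinearMap.trace ℝ E B ≤ 0 := by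
    have hs := hder.hasDerivWithinAt (s := Set.Ioi 0)
    rw [hasDerivWithinAt_iff_tendsto_slope' (by simp)] at hs
    refine le_of_tendsto hs ?_
    filter_upwards [Ioo_mem_nhdsGT (zero_lt_one (α := ℝ))] with t ht
    have := hdet t ht.1.le ht.2.le
    rw [slope_def_field]
    refine div_nonpos_of_nonpos_of_nonneg ?_ (by linarith [ht.1])
    simpa using this
  have : LinearMap.trace ℝ E B = 2⁻¹ * (LinearMap.trace ℝ E A - d) := by
    rw [hB, ContinuousLinearMap.toLinearMap_smul, map_smul, ContinuousLinearMap.toLinearMap_sub,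
      map_sub, ContinuousLinearMap.toLinearMap_one, LinearMap.trace_one, smul_eq_mul]
  linarith

theorem integrable_exp_smul_of_norm_le {E F : Type*} [NormedAddCommGroup E]
    [InnerProductSpace ℝ E] [FiniteDimensional ℝ E] [MeasurableSpace E] [BorelSpace E]
    [NormedAddCommGroup F] [NormedSpace ℝ F] {g : E → F} (hg : Continuous g) (C : ℝ)
    (h : ∀ x, ‖g x‖ ≤ C * (1 + ‖x‖ ^ 2) ^ 2) :
    Integrable (fun x => Real.exp (-‖x‖ ^ 2 / 2) • g x) := by
  have hbase : Integrable (fun x : E => Real.exp (-(1 / 4) * ‖x‖ ^ 2)) := by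
    refine Integrable.of_integral_ne_zero ?_
    rw [GaussianFourier.integral_rexp_neg_mul_sq_norm (by norm_num)]
    positivity
  refine Integrable.mono' (hbase.const_mul (C * (32 * Real.exp (1 / 4))))
    (by fun_prop) (Filter.Eventually.of_forall fun x => ?_)
  have hC : 0 ≤ C := by
    have := (norm_nonneg _).trans (h 0)
    simpa using this
  rw [norm_smul, Real.norm_of_nonneg (Real.exp_pos _).le]
  have h1 : (1 + ‖x‖ ^ 2) ^ 2 ≤ 32 * (Real.exp (1 / 4) * Real.exp (1 / 4 * ‖x‖ ^ 2)) := by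
    have := Real.pow_div_factorial_le_exp ((1 + ‖x‖ ^ 2) / 4) (by positivity) 2
    rw [← Real.exp_add, show 1 / 4 + 1 / 4 * ‖x‖ ^ 2 = (1 + ‖x‖ ^ 2) / 4 by ring]
    norm_num [Nat.factorial] at this
    linarith
  have h2 : Real.exp (1 / 4 * ‖x‖ ^ 2) * Real.exp (-‖x‖ ^ 2 / 2) =
      Real.exp (-(1 / 4) * ‖x‖ ^ 2) := by
    rw [← Real.exp_add]; ring_nf
  calc Real.exp (-‖x‖ ^ 2 / 2) * ‖g x‖
      ≤ Real.exp (-‖x‖ ^ 2 / 2) *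
        (C * (32 * (Real.exp (1 / 4) * Real.exp (1 / 4 * ‖x‖ ^ 2)))) := by
        gcongr
        exact (h x).trans (by gcongr)
    _ = C * (32 * Real.exp (1 / 4)) *
        (Real.exp (1 / 4 * ‖x‖ ^ 2) * Real.exp (-‖x‖ ^ 2 / 2)) := by ring
    _ = _ := by rw [h2]

theorem integrable_exp_mul_of_abs_le {E : Type*} [NormedAddCommGroup E]
    [InnerProductSpace ℝ E] [FiniteDimensional ℝ E] [MeasurableSpace E] [BorelSpace E]
    {g : E → ℝ} (hg : Continuous g) (C : ℝ) (h : ∀ x, |g x| ≤ C * (1 + ‖x‖ ^ 2) ^ 2) :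
    Integrable (fun x => Real.exp (-‖x‖ ^ 2 / 2) * g x) :=
  integrable_exp_smul_of_norm_le hg C h

theorem integrable_exp_neg_norm_sq {E : Type*} [NormedAddCommGroup E]
    [InnerProductSpace ℝ E] [FiniteDimensional ℝ E] [MeasurableSpace E] [BorelSpace E] :
    Integrable (fun x : E => Real.exp (-‖x‖ ^ 2 / 2)) := by
  simpa using integrable_exp_mul_of_abs_le (E := E) (g := fun _ => 1) (by fun_prop) 1 fun x => by
    rw [abs_one, one_mul]
    exact one_le_pow₀ (by linarith [sq_nonneg ‖x‖])

theorem integrable_exp_mul_of_le_norm_sq {E : Type*} [NormedAddCommGroup E]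
    [InnerProductSpace ℝ E] [FiniteDimensional ℝ E] [MeasurableSpace E] [BorelSpace E]
    {f : E → ℝ} (hf : Continuous f) (hf0 : ∀ x, 0 ≤ f x) {M : ℝ} (hM : ∀ x, f x ≤ M * ‖x‖ ^ 2) :
    Integrable (fun x => Real.exp (-‖x‖ ^ 2 / 2) * f x) := by
  have hM' : ∀ x, f x ≤ |M| * ‖x‖ ^ 2 := fun x =>
    (hM x).trans (by gcongr; exact le_abs_self M)
  exact integrable_exp_mul_of_abs_le hf |M| fun x => by
    rw [abs_of_nonneg (hf0 x)]
    refine (hM' x).trans ?_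
    gcongr
    nlinarith [sq_nonneg ‖x‖, sq_nonneg (‖x‖ ^ 2)]

theorem integrable_exp_mul_norm_sq_of_le_norm_sq {E : Type*} [NormedAddCommGroup E]
    [InnerProductSpace ℝ E] [FiniteDimensional ℝ E] [MeasurableSpace E] [BorelSpace E]
    {f : E → ℝ} (hf : Continuous f) (hf0 : ∀ x, 0 ≤ f x) {M : ℝ} (hM : ∀ x, f x ≤ M * ‖x‖ ^ 2) :
    Integrable (fun x => Real.exp (-‖x‖ ^ 2 / 2) * (f x * ‖x‖ ^ 2)) := by
  have hM' : ∀ x, f x ≤ |M| * ‖x‖ ^ 2 := fun x =>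
    (hM x).trans (by gcongr; exact le_abs_self M)
  exact integrable_exp_mul_of_abs_le (by fun_prop) |M| fun x => by
    rw [abs_of_nonneg (mul_nonneg (hf0 x) (sq_nonneg _))]
    calc f x * ‖x‖ ^ 2 ≤ |M| * ‖x‖ ^ 2 * ‖x‖ ^ 2 := by gcongr; exact hM' x
      _ = |M| * (‖x‖ ^ 2 * ‖x‖ ^ 2) := by ring
      _ ≤ _ := by
        gcongr
        nlinarith [sq_nonneg ‖x‖, sq_nonneg (‖x‖ ^ 2)]

theorem integral_exp_mul_norm_sq_mul {E : Type*} [NormedAddCommGroup E]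
    [InnerProductSpace ℝ E] [FiniteDimensional ℝ E] [MeasurableSpace E] [BorelSpace E]
    {f : E → ℝ} (hf : Continuous f) (hf0 : ∀ x, 0 ≤ f x) {M : ℝ} (hM : ∀ x, f x ≤ M * ‖x‖ ^ 2)
    (hhom : ∀ (c : ℝ) (x : E), 0 ≤ c → f (c • x) = c ^ 2 * f x) :
    ∫ x, Real.exp (-‖x‖ ^ 2 / 2) * (f x * ‖x‖ ^ 2) =
      (Module.finrank ℝ E + 2) * ∫ x, Real.exp (-‖x‖ ^ 2 / 2) * f x := by
  set d := Module.finrank ℝ E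
  have hi1 : Integrable (fun x => Real.exp (-‖x‖ ^ 2 / 2) * f x) :=
    integrable_exp_mul_of_le_norm_sq hf hf0 hM
  have hi2 : Integrable (fun x => Real.exp (-‖x‖ ^ 2 / 2) * (f x * ‖x‖ ^ 2)) :=
    integrable_exp_mul_norm_sq_of_le_norm_sq hf hf0 hM
  set I := ∫ x, Real.exp (-‖x‖ ^ 2 / 2) * f x with hI
  set J := ∫ x, Real.exp (-‖x‖ ^ 2 / 2) * (f x * ‖x‖ ^ 2) with hJ
  have key : ∀ b : ℝ, 0 < b → b ^ (d + 2) * (I - (b ^ 2 - 1) / 2 * J) ≤ I := by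
    intro b hb
    have hcomp := Measure.integral_comp_smul volume
      (fun x : E => Real.exp (-‖x‖ ^ 2 / 2) * f x) b
    have hint : Integrable (fun x : E => Real.exp (-‖b • x‖ ^ 2 / 2) * f (b • x)) :=
      hi1.comp_smul hb.ne'
    have hle : b ^ 2 * (I - (b ^ 2 - 1) / 2 * J) ≤
        ∫ x, Real.exp (-‖b • x‖ ^ 2 / 2) * f (b • x) := by
      rw [hI, hJ, ← integral_const_mul, ← integral_sub hi1 (hi2.const_mul _), ← integral_const_mul]
      refine integral_mono ((hi1.sub (hi2.const_mul _)).const_mul _) hint fun x => ?_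
      have he : Real.exp (-‖b • x‖ ^ 2 / 2) ≥
          Real.exp (-‖x‖ ^ 2 / 2) * (1 - (b ^ 2 - 1) / 2 * ‖x‖ ^ 2) := by
        rw [norm_smul, mul_pow, Real.norm_eq_abs, sq_abs,
          show -(b ^ 2 * ‖x‖ ^ 2) / 2 = -‖x‖ ^ 2 / 2 + -((b ^ 2 - 1) / 2 * ‖x‖ ^ 2) by ring,
          Real.exp_add]
        gcongr
        have := Real.add_one_le_exp (-((b ^ 2 - 1) / 2 * ‖x‖ ^ 2))
        linarith
      simp only [hhom b x hb.le]
      calc b ^ 2 * (Real.exp (-‖x‖ ^ 2 / 2) * f x -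
            (b ^ 2 - 1) / 2 * (Real.exp (-‖x‖ ^ 2 / 2) * (f x * ‖x‖ ^ 2)))
          = Real.exp (-‖x‖ ^ 2 / 2) * (1 - (b ^ 2 - 1) / 2 * ‖x‖ ^ 2) * (b ^ 2 * f x) := by ring
        _ ≤ _ := by
          gcongr
          exact mul_nonneg (sq_nonneg _) (hf0 x)
    rw [hcomp, smul_eq_mul, abs_of_pos (by positivity)] at hle
    calc b ^ (d + 2) * (I - (b ^ 2 - 1) / 2 * J)
        = b ^ d * (b ^ 2 * (I - (b ^ 2 - 1) / 2 * J)) := by ring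
      _ ≤ b ^ d * ((b ^ d)⁻¹ * I) := by gcongr
      _ = I := by field_simp
  have hmax : IsLocalMax (fun b : ℝ => b ^ (d + 2) * (I - (b ^ 2 - 1) / 2 * J)) 1 := by
    filter_upwards [lt_mem_nhds (zero_lt_one (α := ℝ))] with b hb
    simpa using key b hb
  have hder : HasDerivAt (fun b : ℝ => b ^ (d + 2) * (I - (b ^ 2 - 1) / 2 * J))
      ((d + 2) * I - J) 1 := by
    have h1 := (((((hasDerivAt_pow 2 (1 : ℝ)).sub_const 1).div_const 2).mul_const J).const_sub I)
    exact ((hasDerivAt_pow (d + 2) (1 : ℝ)).mul h1).congr_deriv (by simp; ring)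
  linarith [hmax.hasDerivAt_eq_zero hder]

theorem two_add_sq_le_exp_add_exp_neg (u : ℝ) : 2 + u ^ 2 ≤ Real.exp u + Real.exp (-u) := by
  have h : Real.cosh u = 1 + 2 * Real.sinh (u / 2) ^ 2 := by
    have h1 := Real.cosh_two_mul (u / 2)
    have h2 := Real.cosh_sq (u / 2)
    rw [mul_div_cancel₀ u two_ne_zero] at h1
    linarith
  have h2 : (u / 2) ^ 2 ≤ Real.sinh (u / 2) ^ 2 := by
    rcases le_total 0 (u / 2) with h0 | h0
    · exact pow_le_pow_left₀ h0 (Real.self_le_sinh_iff.2 h0) 2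
    · have := Real.sinh_le_self_iff.2 h0
      nlinarith
  rw [Real.cosh_eq] at h
  linarith

theorem integral_exp_mul_inner_sq_sub_le {E : Type*} [NormedAddCommGroup E]
    [InnerProductSpace ℝ E] [FiniteDimensional ℝ E] [MeasurableSpace E] [BorelSpace E]
    {f : E → ℝ} (hf : Continuous f) (hf0 : ∀ x, 0 ≤ f x) {M : ℝ} (hM : ∀ x, f x ≤ M * ‖x‖ ^ 2)
    (hhom : ∀ (c : ℝ) (x : E), 0 ≤ c → f (c • x) = c ^ 2 * f x) {κ : ℝ}
    (hκ : ∀ x y, f (x + y) + f (x - y) ≤ 2 * f x + κ * f y) (y : E) :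
    ∫ x, Real.exp (-‖x‖ ^ 2 / 2) * (f x * (⟪x, y⟫ ^ 2 - ‖y‖ ^ 2)) ≤
      κ * (∫ x : E, Real.exp (-‖x‖ ^ 2 / 2)) * f y := by
  have hM' : ∀ x, f x ≤ |M| * ‖x‖ ^ 2 := fun x =>
    (hM x).trans (by gcongr; exact le_abs_self M)
  have hi0 : Integrable (fun x : E => Real.exp (-‖x‖ ^ 2 / 2)) := integrable_exp_neg_norm_sq
  have hishift : ∀ z : E, Integrable (fun x => Real.exp (-‖x‖ ^ 2 / 2) * f (x + z)) := fun z =>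
    integrable_exp_mul_of_abs_le (by fun_prop) (|M| * (2 * (1 + ‖z‖ ^ 2))) fun x => by
      rw [abs_of_nonneg (hf0 _), mul_assoc]
      refine (hM' _).trans ?_
      gcongr
      have h1 : ‖x + z‖ ^ 2 ≤ (‖x‖ + ‖z‖) ^ 2 := by gcongr; exact norm_add_le _ _
      nlinarith [sq_nonneg (‖x‖ - ‖z‖), sq_nonneg ‖x‖, sq_nonneg (‖x‖ ^ 2), sq_nonneg ‖z‖,
        mul_nonneg (sq_nonneg ‖x‖) (sq_nonneg ‖z‖),
        mul_nonneg (sq_nonneg (‖x‖ ^ 2)) (sq_nonneg ‖z‖)]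
  have hi1 : Integrable (fun x => Real.exp (-‖x‖ ^ 2 / 2) * f x) := by
    simpa using hishift 0
  have hi2 : ∀ z : E, Integrable (fun x => Real.exp (-‖x‖ ^ 2 / 2) * (f x * ⟪x, z⟫ ^ 2)) :=
    fun z => integrable_exp_mul_of_abs_le (by fun_prop) (|M| * ‖z‖ ^ 2) fun x => by
      rw [abs_of_nonneg (mul_nonneg (hf0 x) (sq_nonneg _))]
      have h1 : ⟪x, z⟫ ^ 2 ≤ (‖x‖ * ‖z‖) ^ 2 := by
        rw [← sq_abs]
        gcongr
        exact abs_real_inner_le_norm x z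
      calc f x * ⟪x, z⟫ ^ 2 ≤ |M| * ‖x‖ ^ 2 * (‖x‖ * ‖z‖) ^ 2 := by gcongr; exact hM' x
        _ = |M| * ‖z‖ ^ 2 * (‖x‖ ^ 2) ^ 2 := by ring
        _ ≤ _ := by gcongr; linarith
  set Z := ∫ x : E, Real.exp (-‖x‖ ^ 2 / 2) with hZ
  set I := ∫ x, Real.exp (-‖x‖ ^ 2 / 2) * f x with hI
  have htrans : ∀ z : E, ∫ x, Real.exp (-‖x‖ ^ 2 / 2) * f (x + z) =
      ∫ x, Real.exp (-‖x - z‖ ^ 2 / 2) * f x := fun z => by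
    rw [← integral_add_right_eq_self (fun x => Real.exp (-‖x - z‖ ^ 2 / 2) * f x) z]
    simp
  have hitrans : ∀ z : E, Integrable (fun x => Real.exp (-‖x - z‖ ^ 2 / 2) * f x) := fun z => by
    simpa using (hishift z).comp_sub_right z
  have hupper : ∀ z : E, (∫ x, Real.exp (-‖x‖ ^ 2 / 2) * f (x + z)) +
      (∫ x, Real.exp (-‖x‖ ^ 2 / 2) * f (x + -z)) ≤ 2 * I + κ * f z * Z := by
    intro z
    rw [← integral_add (hishift z) (hishift (-z)), hI, hZ, ← integral_const_mul,
      ← integral_const_mul, ← integral_add (hi1.const_mul _) (hi0.const_mul _)]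
    refine integral_mono ((hishift z).add (hishift (-z)))
      ((hi1.const_mul _).add (hi0.const_mul _)) fun x => ?_
    have h1 := mul_le_mul_of_nonneg_left (hκ x z) (Real.exp_pos (-‖x‖ ^ 2 / 2)).le
    simp only [← sub_eq_add_neg]
    linarith
  have hlower : ∀ z : E, (2 - ‖z‖ ^ 2) * I +
      (1 - ‖z‖ ^ 2 / 2) * (∫ x, Real.exp (-‖x‖ ^ 2 / 2) * (f x * ⟪x, z⟫ ^ 2)) ≤
      (∫ x, Real.exp (-‖x - z‖ ^ 2 / 2) * f x) +
        ∫ x, Real.exp (-‖x - -z‖ ^ 2 / 2) * f x := by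
    intro z
    rw [← integral_add (hitrans z) (hitrans (-z)), hI, ← integral_const_mul, ← integral_const_mul,
      ← integral_add (hi1.const_mul _) ((hi2 z).const_mul _)]
    refine integral_mono ((hi1.const_mul _).add ((hi2 z).const_mul _))
      ((hitrans z).add (hitrans (-z))) fun x => ?_
    have e1 : Real.exp (-‖x - z‖ ^ 2 / 2) =
        Real.exp (-‖x‖ ^ 2 / 2) * (Real.exp (-(‖z‖ ^ 2 / 2)) * Real.exp ⟪x, z⟫) := by
      rw [norm_sub_sq_real, ← Real.exp_add, ← Real.exp_add]
      ring_nf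
    have e2 : Real.exp (-‖x - -z‖ ^ 2 / 2) =
        Real.exp (-‖x‖ ^ 2 / 2) * (Real.exp (-(‖z‖ ^ 2 / 2)) * Real.exp (-⟪x, z⟫)) := by
      rw [sub_neg_eq_add, norm_add_sq_real, ← Real.exp_add, ← Real.exp_add]
      ring_nf
    have h1 : (1 - ‖z‖ ^ 2 / 2) * (2 + ⟪x, z⟫ ^ 2) ≤
        Real.exp (-(‖z‖ ^ 2 / 2)) * (Real.exp ⟪x, z⟫ + Real.exp (-⟪x, z⟫)) := by
      have h2 := Real.add_one_le_exp (-(‖z‖ ^ 2 / 2))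
      calc _ ≤ Real.exp (-(‖z‖ ^ 2 / 2)) * (2 + ⟪x, z⟫ ^ 2) := by gcongr; linarith
        _ ≤ _ := mul_le_mul_of_nonneg_left (two_add_sq_le_exp_add_exp_neg _) (Real.exp_pos _).le
    have h2 := mul_le_mul_of_nonneg_left h1
      (mul_nonneg (Real.exp_pos (-‖x‖ ^ 2 / 2)).le (hf0 x))
    simp only [e1, e2]
    linarith
  set Q := ∫ x, Real.exp (-‖x‖ ^ 2 / 2) * (f x * ⟪x, y⟫ ^ 2) with hQ
  have hgoal : ∫ x, Real.exp (-‖x‖ ^ 2 / 2) * (f x * (⟪x, y⟫ ^ 2 - ‖y‖ ^ 2)) =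
      Q - ‖y‖ ^ 2 * I := by
    rw [hQ, hI, ← integral_const_mul, ← integral_sub (hi2 y) (hi1.const_mul _)]
    congr 1
    ext x
    ring
  rw [hgoal]
  have hs : ∀ s : ℝ, 0 < s → Q - ‖y‖ ^ 2 * I - s ^ 2 * (‖y‖ ^ 2 / 2 * Q) ≤ κ * Z * f y := by
    intro s hs
    have h1 := hupper (s • y)
    rw [htrans, htrans] at h1
    have h2 := (hlower (s • y)).trans h1
    have hQs : ∫ x, Real.exp (-‖x‖ ^ 2 / 2) * (f x * ⟪x, s • y⟫ ^ 2) = s ^ 2 * Q := by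
      rw [hQ, ← integral_const_mul]
      congr 1
      ext x
      rw [inner_smul_right]
      ring
    rw [hQs, norm_smul, mul_pow, Real.norm_eq_abs, sq_abs, hhom s y hs.le] at h2
    refine le_of_mul_le_mul_left ?_ (pow_pos hs 2)
    linarith
  have hlim : Filter.Tendsto (fun s : ℝ => Q - ‖y‖ ^ 2 * I - s ^ 2 * (‖y‖ ^ 2 / 2 * Q))
      (nhdsWithin 0 (Set.Ioi 0)) (nhds (Q - ‖y‖ ^ 2 * I)) := by
    have hc : Continuous (fun s : ℝ => Q - ‖y‖ ^ 2 * I - s ^ 2 * (‖y‖ ^ 2 / 2 * Q)) := by fun_prop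
    have := (hc.tendsto 0).mono_left (nhdsWithin_le_nhds (s := Set.Ioi 0))
    simpa using this
  refine le_of_tendsto hlim ?_
  filter_upwards [self_mem_nhdsWithin] with s h using hs s h

/-- The Gaussian average of the quadratic forms `f x • (x ⊗ x - 1)`. -/
theorem exists_inner_eq_integral_exp_mul_and_trace_eq {E : Type*} [NormedAddCommGroup E]
    [InnerProductSpace ℝ E] [FiniteDimensional ℝ E] [MeasurableSpace E] [BorelSpace E]
    {f : E → ℝ} (hf : Continuous f) (hf0 : ∀ x, 0 ≤ f x) {M : ℝ} (hM : ∀ x, f x ≤ M * ‖x‖ ^ 2) :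
    ∃ A : E →L[ℝ] E,
      (∀ u, ⟪A u, u⟫ = ∫ x, Real.exp (-‖x‖ ^ 2 / 2) * (f x * (⟪x, u⟫ ^ 2 - ‖u‖ ^ 2))) ∧
      LinearMap.trace ℝ E A =
        ∫ x, Real.exp (-‖x‖ ^ 2 / 2) * (f x * (‖x‖ ^ 2 - Module.finrank ℝ E)) := by
  have hM' : ∀ x, f x ≤ |M| * ‖x‖ ^ 2 := fun x =>
    (hM x).trans (by gcongr; exact le_abs_self M)
  have hgc : Continuous fun x => f x • (InnerProductSpace.rankOne ℝ x x - 1 : E →L[ℝ] E) := by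
    have h1 : Continuous fun x : E => InnerProductSpace.rankOne ℝ x x :=
      (InnerProductSpace.rankOne ℝ).continuous.clm_apply continuous_id
    exact hf.smul (h1.sub continuous_const)
  have hgi : Integrable (fun x => Real.exp (-‖x‖ ^ 2 / 2) •
      (f x • (InnerProductSpace.rankOne ℝ x x - 1 : E →L[ℝ] E))) := by
    refine integrable_exp_smul_of_norm_le hgc |M| fun x => ?_
    rw [norm_smul, Real.norm_of_nonneg (hf0 x)]
    have h1 : ‖(InnerProductSpace.rankOne ℝ x x - 1 : E →L[ℝ] E)‖ ≤ ‖x‖ ^ 2 + 1 := by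
      refine (norm_sub_le _ _).trans (add_le_add ?_ ContinuousLinearMap.norm_id_le)
      rw [InnerProductSpace.norm_rankOne, sq]
    calc _ ≤ |M| * ‖x‖ ^ 2 * (‖x‖ ^ 2 + 1) := by gcongr; exact hM' x
      _ = |M| * (‖x‖ ^ 2 * (‖x‖ ^ 2 + 1)) := by ring
      _ ≤ _ := by gcongr; nlinarith [sq_nonneg ‖x‖]
  refine ⟨∫ x, Real.exp (-‖x‖ ^ 2 / 2) •
    (f x • (InnerProductSpace.rankOne ℝ x x - 1 : E →L[ℝ] E)), fun u => ?_, ?_⟩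
  · have h1 := ((innerSL ℝ u) ∘L (ContinuousLinearMap.apply ℝ E u)).integral_comp_comm hgi
    simp only [ContinuousLinearMap.comp_apply, ContinuousLinearMap.apply_apply,
      innerSL_apply_apply] at h1
    rw [real_inner_comm, ← h1]
    congr 1
    ext x
    simp [inner_sub_right, inner_smul_right, real_inner_comm, sq]
  · obtain ⟨L, hL⟩ : ∃ L : (E →L[ℝ] E) →L[ℝ] ℝ, ∀ B : E →L[ℝ] E, L B = LinearMap.trace ℝ E B :=
      ⟨LinearMap.toContinuousLinearMap
        ((LinearMap.trace ℝ E) ∘ₗ (ContinuousLinearMap.coeLM ℝ)), fun _ => rfl⟩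
    rw [← hL, ← L.integral_comp_comm hgi]
    congr 1
    ext x
    rw [hL]
    simp [InnerProductSpace.trace_rankOne]

theorem integral_exp_mul_le_of_trace_le {E : Type*} [NormedAddCommGroup E]
    [InnerProductSpace ℝ E] [FiniteDimensional ℝ E] [MeasurableSpace E] [BorelSpace E]
    {f : E → ℝ} (hf : Continuous f) (hf0 : ∀ x, 0 ≤ f x) {M : ℝ} (hM : ∀ x, f x ≤ M * ‖x‖ ^ 2)
    (hhom : ∀ (c : ℝ) (x : E), 0 ≤ c → f (c • x) = c ^ 2 * f x) {κ : ℝ} (hκ0 : 0 < κ)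
    (hκ : ∀ x y, f (x + y) + f (x - y) ≤ 2 * f x + κ * f y)
    (htr : ∀ A : E →L[ℝ] E, (∀ u, ⟪A u, u⟫ ≤ f u) →
      LinearMap.trace ℝ E A ≤ Module.finrank ℝ E) :
    ∫ x, Real.exp (-‖x‖ ^ 2 / 2) * f x ≤
      κ * Module.finrank ℝ E / 2 * ∫ x : E, Real.exp (-‖x‖ ^ 2 / 2) := by
  set Z := ∫ x : E, Real.exp (-‖x‖ ^ 2 / 2) with hZ
  have hZ0 : 0 < Z := by
    rw [hZ]
    simp only [show ∀ x : E, -‖x‖ ^ 2 / 2 = -(1 / 2) * ‖x‖ ^ 2 from fun x => by ring]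
    rw [GaussianFourier.integral_rexp_neg_mul_sq_norm (by norm_num)]
    positivity
  obtain ⟨A, hinner, htrace⟩ := exists_inner_eq_integral_exp_mul_and_trace_eq hf hf0 hM
  have hi1 : Integrable (fun x => Real.exp (-‖x‖ ^ 2 / 2) * f x) :=
    integrable_exp_mul_of_le_norm_sq hf hf0 hM
  have hi2 : Integrable (fun x => Real.exp (-‖x‖ ^ 2 / 2) * (f x * ‖x‖ ^ 2)) :=
    integrable_exp_mul_norm_sq_of_le_norm_sq hf hf0 hM
  have htrace' : LinearMap.trace ℝ E A = 2 * ∫ x, Real.exp (-‖x‖ ^ 2 / 2) * f x := by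
    have h1 := integral_exp_mul_norm_sq_mul hf hf0 hM hhom
    have h2 : ∫ x, Real.exp (-‖x‖ ^ 2 / 2) * (f x * (‖x‖ ^ 2 - Module.finrank ℝ E)) =
        (∫ x, Real.exp (-‖x‖ ^ 2 / 2) * (f x * ‖x‖ ^ 2)) -
          Module.finrank ℝ E * ∫ x, Real.exp (-‖x‖ ^ 2 / 2) * f x := by
      rw [← integral_const_mul, ← integral_sub hi2 (hi1.const_mul _)]
      congr 1
      ext x
      ring
    rw [htrace, h2, h1]
    ring
  have hb := htr ((κ * Z)⁻¹ • A) fun u => by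
    rw [_root_.smul_apply, real_inner_smul_left, inv_mul_le_iff₀ (by positivity), hinner]
    exact integral_exp_mul_inner_sq_sub_le hf hf0 hM hhom hκ u
  rw [ContinuousLinearMap.toLinearMap_smul, map_smul, htrace', smul_eq_mul,
    inv_mul_le_iff₀ (by positivity)] at hb
  linarith

theorem integral_exp_le_two_mul_volume {E : Type*} [NormedAddCommGroup E]
    [InnerProductSpace ℝ E] [FiniteDimensional ℝ E] [MeasurableSpace E] [BorelSpace E]
    {f : E → ℝ} (hf : Continuous f) (hf0 : ∀ x, 0 ≤ f x)
    (hint : Integrable (fun x => Real.exp (-‖x‖ ^ 2 / 2) * f x)) {a : ℝ} (ha : 0 < a)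
    (hfin : volume {x | f x ≤ a} ≠ ⊤)
    (h : ∫ x, Real.exp (-‖x‖ ^ 2 / 2) * f x ≤ a / 2 * ∫ x : E, Real.exp (-‖x‖ ^ 2 / 2)) :
    ∫ x : E, Real.exp (-‖x‖ ^ 2 / 2) ≤ 2 * (volume {x | f x ≤ a}).toReal := by
  have hi0 : Integrable (fun x : E => Real.exp (-‖x‖ ^ 2 / 2)) := integrable_exp_neg_norm_sq
  have hmeas : MeasurableSet {x | f x ≤ a} := measurableSet_le hf.measurable measurable_const
  have h1 : (∫ x : E, Real.exp (-‖x‖ ^ 2 / 2)) - a⁻¹ * ∫ x, Real.exp (-‖x‖ ^ 2 / 2) * f x ≤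
      (volume {x | f x ≤ a}).toReal := by
    rw [← integral_const_mul, ← integral_sub hi0 (hint.const_mul _), ← measureReal_def,
      ← integral_indicator_one hmeas]
    refine integral_mono (hi0.sub (hint.const_mul _))
      ((integrable_indicator_iff hmeas).2 (integrableOn_const hfin)) fun x => ?_
    have he := (Real.exp_pos (-‖x‖ ^ 2 / 2)).le
    have he1 : Real.exp (-‖x‖ ^ 2 / 2) ≤ 1 :=
      Real.exp_le_one_iff.2 (by linarith [sq_nonneg ‖x‖])
    have heq : Real.exp (-‖x‖ ^ 2 / 2) - a⁻¹ * (Real.exp (-‖x‖ ^ 2 / 2) * f x) =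
        Real.exp (-‖x‖ ^ 2 / 2) * (1 - a⁻¹ * f x) := by ring
    simp only [heq]
    by_cases hx : f x ≤ a
    · rw [Set.indicator_of_mem (by exact hx), Pi.one_apply]
      have h2 : 1 - a⁻¹ * f x ≤ 1 :=
        sub_le_self _ (mul_nonneg (inv_nonneg.2 ha.le) (hf0 x))
      exact (mul_le_of_le_one_right he h2).trans he1
    · rw [Set.indicator_of_notMem (by exact hx)]
      refine mul_nonpos_of_nonneg_of_nonpos he ?_
      rw [sub_nonpos, ← div_eq_inv_mul, one_le_div ha]
      exact (not_le.1 hx).le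
  have h2 : a⁻¹ * ∫ x, Real.exp (-‖x‖ ^ 2 / 2) * f x ≤
      1 / 2 * ∫ x : E, Real.exp (-‖x‖ ^ 2 / 2) := by
    rw [inv_mul_le_iff₀ ha]
    linarith
  linarith

theorem sqrt_pow_mul_volume_closedBall_le {E : Type*} [NormedAddCommGroup E]
    [InnerProductSpace ℝ E] [FiniteDimensional ℝ E] [MeasurableSpace E] [BorelSpace E]
    {r : ℝ} (hr : 0 ≤ r) :
    r ^ Module.finrank ℝ E * (volume (Metric.closedBall (0 : E) 1)).toReal ≤
      Real.exp (r ^ 2 / 2) * ∫ x : E, Real.exp (-‖x‖ ^ 2 / 2) := by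
  have hi0 : Integrable (fun x : E => Real.exp (-‖x‖ ^ 2 / 2)) := integrable_exp_neg_norm_sq
  have h1 : r ^ Module.finrank ℝ E * (volume (Metric.closedBall (0 : E) 1)).toReal =
      (volume (Metric.closedBall (0 : E) r)).toReal := by
    rw [Measure.addHaar_closedBall' volume (0 : E) hr, ENNReal.toReal_mul,
      ENNReal.toReal_ofReal (by positivity)]
  rw [h1, ← measureReal_def, ← integral_indicator_one measurableSet_closedBall,
    ← integral_const_mul]
  refine integral_mono ((integrable_indicator_iff measurableSet_closedBall).2
    (integrableOn_const measure_closedBall_lt_top.ne)) (hi0.const_mul _) fun x => ?_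
  by_cases hx : x ∈ Metric.closedBall (0 : E) r
  · rw [Set.indicator_of_mem hx, Pi.one_apply, ← Real.exp_add, Real.one_le_exp_iff]
    rw [mem_closedBall_zero_iff] at hx
    have : ‖x‖ ^ 2 ≤ r ^ 2 := by gcongr
    linarith
  · rw [Set.indicator_of_notMem hx]
    positivity

open scoped Pointwise in
theorem IsSymmConvexBody.subset_smul_of_gauge_le {E : Type*} [NormedAddCommGroup E]
    [NormedSpace ℝ E] {K : Set E} (hK : IsSymmConvexBody K) {R : ℝ} (hR : 0 < R) :
    {x | gauge K x ≤ R} ⊆ R • K := by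
  intro x hx
  rw [Set.mem_smul_set_iff_inv_smul_mem₀ hR.ne', ← hK.1.isClosed.closure_eq,
    ← gauge_le_one_iff_mem_closure hK.2.1 hK.mem_nhds_zero_s11,
    gauge_smul_of_nonneg (inv_nonneg.2 hR.le), smul_eq_mul, inv_mul_le_iff₀ hR, mul_one]
  exact hx

open scoped Pointwise in
theorem exists_equiv_volume_le_of_isTwoSmooth {E : Type*} [NormedAddCommGroup E]
    [InnerProductSpace ℝ E] [FiniteDimensional ℝ E] [Nontrivial E] [MeasurableSpace E]
    [BorelSpace E] {K : Set E} (hK : IsSymmConvexBody K) {β : ℝ} (hβ : 0 < β)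
    (h : IsTwoSmooth K β) :
    ∃ T : E ≃L[ℝ] E, (∀ x ∈ K, ‖T x‖ ≤ 1) ∧
      ∫ x : E, Real.exp (-‖x‖ ^ 2 / 2) ≤
        2 * (|(T : E →L[ℝ] E).det| *
          (Real.sqrt (20 * β * Module.finrank ℝ E) ^ Module.finrank ℝ E *
            (volume K).toReal)) := by
  obtain ⟨T, hT, hmax⟩ := exists_equiv_det_maximal hK.1.isBounded hK.mem_nhds_zero_s11
  refine ⟨T, hT, ?_⟩
  set d := Module.finrank ℝ E with hd
  have hd0 : 0 < d := Module.finrank_pos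
  set f : E → ℝ := fun x => gauge K (T.symm x) ^ 2 with hf
  have hgc : Continuous (gauge K) := continuous_gauge hK.2.1 hK.mem_nhds_zero_s11
  have hfc : Continuous f := by fun_prop
  have hf0 : ∀ x, 0 ≤ f x := fun x => sq_nonneg _
  obtain ⟨r, hr, hrK⟩ := Metric.mem_nhds_iff.1 hK.mem_nhds_zero_s11
  have hM : ∀ x, f x ≤ (r⁻¹ * ‖(T.symm : E →L[ℝ] E)‖) ^ 2 * ‖x‖ ^ 2 := by
    intro x
    rw [← mul_pow]
    refine pow_le_pow_left₀ (gauge_nonneg _) ?_ 2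
    have h1 : gauge K (T.symm x) ≤ r⁻¹ * ‖T.symm x‖ := by
      rw [← div_eq_inv_mul, le_div_iff₀' hr]
      exact mul_gauge_le_norm hrK
    refine h1.trans ?_
    rw [mul_assoc]
    gcongr
    exact (T.symm : E →L[ℝ] E).le_opNorm x
  have hhom : ∀ (c : ℝ) (x : E), 0 ≤ c → f (c • x) = c ^ 2 * f x := by
    intro c x hc
    simp only [hf, map_smul, gauge_smul_of_nonneg hc, smul_eq_mul, mul_pow]
  have hκ : ∀ x y, f (x + y) + f (x - y) ≤ 2 * f x + 20 * β * f y := by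
    intro x y
    simp only [hf, map_add, map_sub]
    exact sq_gauge_add_le_of_isTwoSmooth hK h _ _
  have htr : ∀ A : E →L[ℝ] E, (∀ u, ⟪A u, u⟫ ≤ f u) → LinearMap.trace ℝ E A ≤ d := by
    intro A hA
    refine trace_le_finrank_of_det_maximal hT hmax fun x hx => (hA _).trans ?_
    simp only [hf, ContinuousLinearEquiv.symm_apply_apply]
    exact pow_le_one₀ (gauge_nonneg _) (gauge_le_one_of_mem hx)
  set a : ℝ := 20 * β * d with ha
  have ha0 : 0 < a := by positivity
  have hsub : {x | f x ≤ a} ⊆ (T : E →ₗ[ℝ] E) '' (Real.sqrt a • K) := by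
    intro x hx
    refine ⟨T.symm x, hK.subset_smul_of_gauge_le (Real.sqrt_pos.2 ha0) ?_, by simp⟩
    exact Real.le_sqrt_of_sq_le hx
  have hvol : volume ((T : E →ₗ[ℝ] E) '' (Real.sqrt a • K)) =
      ENNReal.ofReal |(T : E →L[ℝ] E).det| * (ENNReal.ofReal (Real.sqrt a ^ d) * volume K) := by
    rw [Measure.addHaar_image_linearMap, Measure.addHaar_smul,
      abs_of_nonneg (pow_nonneg (Real.sqrt_nonneg a) _)]
    rfl
  have hfin : volume ((T : E →ₗ[ℝ] E) '' (Real.sqrt a • K)) ≠ ⊤ := by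
    rw [hvol]
    exact ENNReal.mul_ne_top ENNReal.ofReal_ne_top
      (ENNReal.mul_ne_top ENNReal.ofReal_ne_top hK.1.measure_lt_top.ne)
  have h1 := integral_exp_le_two_mul_volume hfc hf0 (integrable_exp_mul_of_le_norm_sq hfc hf0 hM)
    ha0 (ne_top_of_le_ne_top hfin (measure_mono hsub))
    (integral_exp_mul_le_of_trace_le hfc hf0 hM hhom (by positivity) hκ htr)
  have h2 := ENNReal.toReal_mono hfin (measure_mono hsub)
  rw [hvol, ENNReal.toReal_mul, ENNReal.toReal_mul, ENNReal.toReal_ofReal (abs_nonneg _),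
    ENNReal.toReal_ofReal (by positivity)] at h2
  linarith

theorem twoSmooth_outer_volume_ratio :
    ∃ C : ℝ, 0 < C ∧ ∀ (n : ℕ) (K : Set (EuclideanSpace ℝ (Fin n))) (β : ℝ),
      0 < n → IsSymmConvexBody K → 0 < β → IsTwoSmooth K β →
      ∃ A : Set (EuclideanSpace ℝ (Fin n)), IsEllipsoid A ∧ K ⊆ A ∧
        ((volume A).toReal / (volume K).toReal) ^ ((1 : ℝ) / n) ≤
          C * Real.sqrt β := by
  refine ⟨2 * Real.exp (1 / 2) * Real.sqrt 20, by positivity, ?_⟩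
  intro n K β hn hK hβ h
  have : Nonempty (Fin n) := ⟨⟨0, hn⟩⟩
  obtain ⟨T, hT, hvol⟩ := exists_equiv_volume_le_of_isTwoSmooth hK hβ h
  rw [finrank_euclideanSpace_fin] at hvol
  refine ⟨T.symm.toLinearEquiv '' Metric.closedBall 0 1, ⟨_, rfl⟩, fun x hx => ?_, ?_⟩
  · exact ⟨T x, by simpa using hT x hx, by simp⟩
  have hVK : 0 < (volume K).toReal :=
    ENNReal.toReal_pos (Measure.measure_pos_of_mem_nhds volume hK.mem_nhds_zero_s11).ne'
      hK.1.measure_lt_top.ne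
  have hdet : (0 : ℝ) < |(T : EuclideanSpace ℝ (Fin n) →L[ℝ] EuclideanSpace ℝ (Fin n)).det| :=
    abs_pos.2 (LinearEquiv.isUnit_det' T.toLinearEquiv).ne_zero
  have hA : |(T : EuclideanSpace ℝ (Fin n) →L[ℝ] EuclideanSpace ℝ (Fin n)).det| *
      (volume (T.symm.toLinearEquiv '' Metric.closedBall 0 1)).toReal =
      (volume (Metric.closedBall (0 : EuclideanSpace ℝ (Fin n)) 1)).toReal := by
    have h1 := Measure.addHaar_image_linearMap volume
      (T : EuclideanSpace ℝ (Fin n) →ₗ[ℝ] EuclideanSpace ℝ (Fin n))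
      (T.symm.toLinearEquiv '' Metric.closedBall 0 1)
    rw [← Set.image_comp] at h1
    have h2 : ((T : EuclideanSpace ℝ (Fin n) →ₗ[ℝ] EuclideanSpace ℝ (Fin n)) ∘
        T.symm.toLinearEquiv) = id := by
      ext1 x
      simp
    rw [h2, Set.image_id] at h1
    rw [h1, ENNReal.toReal_mul, ENNReal.toReal_ofReal (abs_nonneg _)]
    rfl
  have hball := sqrt_pow_mul_volume_closedBall_le (E := EuclideanSpace ℝ (Fin n))
    (Real.sqrt_nonneg n)
  rw [finrank_euclideanSpace_fin, Real.sq_sqrt n.cast_nonneg, ← hA] at hball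
  set D := |(T : EuclideanSpace ℝ (Fin n) →L[ℝ] EuclideanSpace ℝ (Fin n)).det|
  set VA := (volume (T.symm.toLinearEquiv '' Metric.closedBall 0 1)).toReal
  set VK := (volume K).toReal
  have hn0 : (0 : ℝ) < Real.sqrt n := Real.sqrt_pos.2 (by exact_mod_cast hn)
  have hexp : Real.exp (n / 2) = Real.exp (1 / 2) ^ n := by
    rw [← Real.exp_nat_mul]
    ring_nf
  have hsqrt : Real.sqrt (20 * β * n) = Real.sqrt 20 * Real.sqrt β * Real.sqrt n := by
    rw [Real.sqrt_mul (by positivity), Real.sqrt_mul (by norm_num)]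
  have hratio : VA / VK ≤ (2 * Real.exp (1 / 2) * Real.sqrt 20 * Real.sqrt β) ^ n := by
    rw [div_le_iff₀ hVK]
    refine le_of_mul_le_mul_left ?_ (mul_pos (pow_pos hn0 n) hdet)
    have h2n : (2 : ℝ) ≤ 2 ^ n := le_self_pow₀ one_le_two hn.ne'
    calc Real.sqrt n ^ n * D * VA = Real.sqrt n ^ n * (D * VA) := by ring
      _ ≤ Real.exp (n / 2) * (2 * (D * (Real.sqrt (20 * β * n) ^ n * VK))) :=
        hball.trans (by gcongr)
      _ ≤ Real.exp (n / 2) * (2 ^ n * (D * (Real.sqrt (20 * β * n) ^ n * VK))) := by gcongr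
      _ = _ := by
        rw [hexp, hsqrt]
        ring
  calc (VA / VK) ^ ((1 : ℝ) / n)
      ≤ ((2 * Real.exp (1 / 2) * Real.sqrt 20 * Real.sqrt β) ^ n) ^ ((1 : ℝ) / n) := by
        gcongr
    _ = _ := by rw [one_div (n : ℝ), Real.pow_rpow_inv_natCast (by positivity) hn.ne']
end
end

section
/- There exists a universal constant C > 0 with the following property. Let K ⊂ ℝⁿ be a centrally symmetric convex body which is 2-convex with constant α > 0, and suppose K is in John's maximal-volume ellipsoid position. Then M*(K)·b(K) ≤ C/√α, where b(K) = max_{θ∈S^{n−1}} ‖θ‖_K. -/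
open MeasureTheory
open scoped RealInnerProductSpace

noncomputable section

/-- The uniform (rotation-invariant) probability measure on the unit sphere `S^{n-1}`,
realized as the normalized `(n-1)`-dimensional Hausdorff measure on the sphere. -/
def sphereMeasure (n : ℕ) : Measure (EuclideanSpace ℝ (Fin n)) :=
  (μH[(n : ℝ) - 1] (Metric.sphere (0 : EuclideanSpace ℝ (Fin n)) 1))⁻¹ •
    (μH[(n : ℝ) - 1]).restrict (Metric.sphere (0 : EuclideanSpace ℝ (Fin n)) 1)

/-- The mean-width parameter `M*(K) = ∫_{S^{n-1}} ‖θ‖*_K dσ(θ)`. -/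
def MStar {n : ℕ} (K : Set (EuclideanSpace ℝ (Fin n))) : ℝ :=
  ∫ θ, dualNorm K θ ∂(sphereMeasure n)

section SupportFunction

variable {n : ℕ} {K : Set (EuclideanSpace ℝ (Fin n))} {θ θ' x y y' : EuclideanSpace ℝ (Fin n)}

theorem inner_le_dualNorm (hK : IsCompact K) (hy : y ∈ K) : ⟪θ, y⟫ ≤ dualNorm K θ :=
  le_csSup (hK.image (by fun_prop)).bddAbove ⟨y, hy, rfl⟩

theorem exists_inner_eq_dualNorm (hK : IsCompact K) (hne : K.Nonempty)
    (θ : EuclideanSpace ℝ (Fin n)) : ∃ y ∈ K, ⟪θ, y⟫ = dualNorm K θ := by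
  obtain ⟨y, hy, h⟩ := hK.exists_sSup_image_eq hne
    (f := fun y => ⟪θ, y⟫) (by fun_prop)
  exact ⟨y, hy, h.symm⟩

theorem dualNorm_le {a : ℝ} (hne : K.Nonempty) (h : ∀ y ∈ K, ⟪θ, y⟫ ≤ a) : dualNorm K θ ≤ a :=
  csSup_le (hne.image _) (by rintro _ ⟨y, hy, rfl⟩; exact h y hy)

theorem abs_inner_le_dualNorm (hK : IsCompact K) (hsymm : K = -K) (hy : y ∈ K) :
    |⟪θ, y⟫| ≤ dualNorm K θ := by
  refine abs_le'.2 ⟨inner_le_dualNorm hK hy, ?_⟩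
  rw [← inner_neg_right]
  refine inner_le_dualNorm hK ?_
  rw [hsymm]
  simpa using hy

theorem gauge_pos_of_isCompact (hK : IsCompact K) (h0 : K ∈ nhds 0) (hx : x ≠ 0) :
    0 < gauge K x :=
  (gauge_pos (absorbent_nhds_zero h0) ((NormedSpace.isVonNBounded_iff ℝ).2 hK.isBounded)).2 hx

theorem inv_gauge_smul_mem (hK : IsCompact K) (hc : Convex ℝ K) (h0 : K ∈ nhds 0)
    (hx : x ≠ 0) : (gauge K x)⁻¹ • x ∈ K := by
  have hg := gauge_pos_of_isCompact hK h0 hx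
  refine hK.isClosed.closure_subset ((gauge_le_one_iff_mem_closure hc h0).1 ?_)
  rw [gauge_smul_of_nonneg (inv_nonneg.2 hg.le), smul_eq_mul, inv_mul_cancel₀ hg.ne']

theorem abs_inner_le_dualNorm_mul_gauge (hK : IsCompact K) (hc : Convex ℝ K) (hsymm : K = -K)
    (h0 : K ∈ nhds 0) (θ x : EuclideanSpace ℝ (Fin n)) :
    |⟪θ, x⟫| ≤ dualNorm K θ * gauge K x := by
  rcases eq_or_ne x 0 with rfl | hx
  · simp
  have hg := gauge_pos_of_isCompact hK h0 hx
  have h := abs_inner_le_dualNorm (θ := θ) hK hsymm (inv_gauge_smul_mem hK hc h0 hx)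
  rwa [inner_smul_right, abs_mul, abs_inv, abs_of_pos hg, inv_mul_le_iff₀ hg, mul_comm] at h

theorem mul_norm_le_dualNorm {r : ℝ} (hK : IsCompact K) (hr : 0 ≤ r)
    (hrK : Metric.closedBall 0 r ⊆ K) (θ : EuclideanSpace ℝ (Fin n)) :
    r * ‖θ‖ ≤ dualNorm K θ := by
  rcases eq_or_ne θ 0 with rfl | hθ
  · simpa using inner_le_dualNorm (θ := 0) hK (hrK (Metric.mem_closedBall_self hr))
  have hθ' : 0 < ‖θ‖ := norm_pos_iff.2 hθ
  have hmem : (r * ‖θ‖⁻¹) • θ ∈ K := hrK (by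
    rw [mem_closedBall_zero_iff, norm_smul, Real.norm_of_nonneg (by positivity), mul_assoc,
      inv_mul_cancel₀ hθ'.ne', mul_one])
  have h := inner_le_dualNorm (θ := θ) hK hmem
  rw [inner_smul_right, real_inner_self_eq_norm_sq] at h
  have : r * ‖θ‖⁻¹ * ‖θ‖ ^ 2 = r * ‖θ‖ := by field_simp
  linarith

end SupportFunction

section TwoConvex

variable {n : ℕ} {K : Set (EuclideanSpace ℝ (Fin n))} {α : ℝ}

theorem IsTwoConvex.gauge_midpoint_le (hc : Convex ℝ K) (hsymm : K = -K) (h0 : K ∈ nhds 0)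
    (hα : IsTwoConvex K α) {x y : EuclideanSpace ℝ (Fin n)} (hx : gauge K x ≤ 1)
    (hy : gauge K y ≤ 1) (hxy : 0 < gauge K (x - y)) :
    gauge K ((2 : ℝ)⁻¹ • (x + y)) ≤ 1 - α * gauge K (x - y) ^ 2 := by
  have habs := absorbent_nhds_zero (𝕜 := ℝ) h0
  have hneg : ∀ z, gauge K (-z) = gauge K z :=
    gauge_neg fun z hz => by rw [hsymm]; simpa using hz
  have hle : gauge K (x - y) ≤ 2 := by
    have := gauge_add_le hc habs x (-y)
    rw [hneg, ← sub_eq_add_neg] at this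
    linarith
  have hinf := hα _ hxy hle
  have hbdd : BddBelow { d | ∃ x' y' : EuclideanSpace ℝ (Fin n), gauge K x' ≤ 1 ∧
      gauge K y' ≤ 1 ∧ gauge K (x - y) ≤ gauge K (x' - y') ∧
      d = 1 - gauge K ((2:ℝ)⁻¹ • (x' + y')) } := by
    refine ⟨0, ?_⟩
    rintro _ ⟨x', y', hx', hy', -, rfl⟩
    have := gauge_add_le hc habs x' y'
    rw [gauge_smul_of_nonneg (by norm_num), smul_eq_mul]
    linarith
  have := hinf.trans (csInf_le hbdd ⟨x, y, hx, hy, le_rfl, rfl⟩)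
  linarith

theorem IsTwoConvex.mul_gauge_sq_le_inner (hK : IsCompact K) (hc : Convex ℝ K) (hsymm : K = -K)
    (h0 : K ∈ nhds 0) (hα : IsTwoConvex K α) {θ θ' y y' : EuclideanSpace ℝ (Fin n)}
    (hy : y ∈ K) (hy' : y' ∈ K) (hθ : ⟪θ, y⟫ = dualNorm K θ) (hθ' : ⟪θ', y'⟫ = dualNorm K θ') :
    2 * α * gauge K (y - y') ^ 2 * (dualNorm K θ + dualNorm K θ') ≤ ⟪θ - θ', y - y'⟫ := by
  rcases eq_or_ne (y - y') 0 with h | h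
  · simp [h]
  have hmid := hα.gauge_midpoint_le hc hsymm h0 (gauge_le_one_of_mem hy)
    (gauge_le_one_of_mem hy') (gauge_pos_of_isCompact hK h0 h)
  have key : ∀ η : EuclideanSpace ℝ (Fin n), ⟪η, y⟫ + ⟪η, y'⟫ ≤
      2 * (dualNorm K η * (1 - α * gauge K (y - y') ^ 2)) := by
    intro η
    have h1 := (le_abs_self _).trans
      (abs_inner_le_dualNorm_mul_gauge hK hc hsymm h0 η ((2 : ℝ)⁻¹ • (y + y')))
    have h2 : 0 ≤ dualNorm K η := by
      simpa using inner_le_dualNorm (θ := η) hK (mem_of_mem_nhds h0)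
    have h3 := mul_le_mul_of_nonneg_left hmid h2
    rw [inner_smul_right, inner_add_right] at h1
    linarith
  have k1 := key θ
  have k2 := key θ'
  simp only [inner_sub_left, inner_sub_right]
  linarith

theorem IsTwoConvex.four_mul_le_one {r : ℝ} (hn : 0 < n) (hK : IsCompact K) (hc : Convex ℝ K)
    (hsymm : K = -K) (hr : 0 < r) (hrK : Metric.closedBall 0 r ⊆ K) (hα : IsTwoConvex K α) :
    4 * α ≤ 1 := by
  have h0 : K ∈ nhds 0 := Filter.mem_of_superset (Metric.closedBall_mem_nhds _ hr) hrK
  have : Nonempty (Fin n) := ⟨⟨0, hn⟩⟩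
  obtain ⟨x, hx⟩ := exists_ne (0 : EuclideanSpace ℝ (Fin n))
  have hg := gauge_pos_of_isCompact hK h0 hx
  set z := (gauge K x)⁻¹ • x
  have hz : gauge K z = 1 := by
    rw [gauge_smul_of_nonneg (inv_nonneg.2 hg.le), smul_eq_mul, inv_mul_cancel₀ hg.ne']
  have hz' : gauge K (-z) = 1 := by
    rw [gauge_neg fun z hz => by rw [hsymm]; simpa using hz]; exact hz
  have h2 : gauge K (z - -z) = 2 := by
    rw [sub_neg_eq_add, ← two_smul ℝ, gauge_smul_of_nonneg (by norm_num), hz]; simp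
  have := hα.gauge_midpoint_le hc hsymm h0 hz.le hz'.le (by rw [h2]; norm_num)
  rw [h2] at this
  simp at this
  linarith

end TwoConvex

section John

variable {n : ℕ} {K : Set (EuclideanSpace ℝ (Fin n))} {r : ℝ}

theorem image_closedBall_subset_of_inner_le (hK : IsCompact K) (hc : Convex ℝ K) (hr : 0 < r)
    (h0 : K ∈ nhds 0) {T : EuclideanSpace ℝ (Fin n) →ₗ[ℝ] EuclideanSpace ℝ (Fin n)}
    (hT : ∀ u v, dualNorm K u ≤ r → ‖v‖ ≤ 1 → ⟪u, T v⟫ ≤ r) :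
    T '' Metric.closedBall 0 1 ⊆ K := by
  rintro _ ⟨v, hv, rfl⟩
  by_contra hmem
  obtain ⟨f, s, hs, hsv⟩ := geometric_hahn_banach_closed_point hc hK.isClosed hmem
  set u := (InnerProductSpace.toDual ℝ (EuclideanSpace ℝ (Fin n))).symm f with hu
  have hf : ∀ x, f x = ⟪u, x⟫ := fun x => by simp [hu]
  have hs0 : 0 < s := by simpa using hs 0 (mem_of_mem_nhds h0)
  have hpos : 0 < r / s := by positivity
  have hle : dualNorm K ((r / s) • u) ≤ r := by
    refine dualNorm_le ⟨0, mem_of_mem_nhds h0⟩ fun y hy => ?_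
    rw [real_inner_smul_left, ← hf, div_mul_eq_mul_div, div_le_iff₀ hs0]
    exact mul_le_mul_of_nonneg_left (hs y hy).le hr.le
  have h := hT _ v hle (by simpa using hv)
  rw [real_inner_smul_left, ← hf, div_mul_eq_mul_div, div_le_iff₀ hs0] at h
  exact absurd (le_of_mul_le_mul_left h hr) (not_le.2 hsv)

theorem abs_det_le_of_image_subset (hr : 0 < r)
    (hmax : ∀ A : Set (EuclideanSpace ℝ (Fin n)), IsEllipsoid A → A ⊆ K →
      volume A ≤ volume (Metric.closedBall (0 : EuclideanSpace ℝ (Fin n)) r))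
    {T : EuclideanSpace ℝ (Fin n) →ₗ[ℝ] EuclideanSpace ℝ (Fin n)}
    (hT : T '' Metric.closedBall 0 1 ⊆ K) : |LinearMap.det T| ≤ r ^ n := by
  rcases eq_or_ne (LinearMap.det T) 0 with h | h
  · rw [h, abs_zero]; positivity
  have hvol := hmax _ ⟨LinearEquiv.ofIsUnitDet (f := T) (v := Module.finBasis ℝ _)
    (v' := Module.finBasis ℝ _) (by rw [LinearMap.det_toMatrix]; exact h.isUnit), rfl⟩ hT
  have h1 : volume (T '' Metric.closedBall 0 1) =
    ENNReal.ofReal |LinearMap.det T| * volume (Metric.closedBall (0 : EuclideanSpace ℝ (Fin n)) 1) :=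
    Measure.addHaar_image_linearMap _ _ _
  have h2 : volume (Metric.closedBall (0 : EuclideanSpace ℝ (Fin n)) r) =
      ENNReal.ofReal (r ^ n) * volume (Metric.closedBall (0 : EuclideanSpace ℝ (Fin n)) 1) := by
    rw [Measure.addHaar_closedBall' _ _ hr.le, finrank_euclideanSpace_fin]
  have h3 : ENNReal.ofReal |LinearMap.det T| *
      volume (Metric.closedBall (0 : EuclideanSpace ℝ (Fin n)) 1) ≤
      ENNReal.ofReal (r ^ n) * volume (Metric.closedBall (0 : EuclideanSpace ℝ (Fin n)) 1) := by
    rw [← h1, ← h2]; exact hvol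
  rw [ENNReal.mul_le_mul_iff_left (Metric.measure_closedBall_pos _ _ one_pos).ne'
    measure_closedBall_lt_top.ne] at h3
  exact (ENNReal.ofReal_le_ofReal_iff (by positivity)).1 h3

theorem trace_le_of_forall_det_one_add_smul_le {M : Matrix (Fin n) (Fin n) ℝ}
    (h : ∀ t : ℝ, 0 < t → t < 1 → (1 + t • M).det ≤ 1) : M.trace ≤ 0 := by
  set p : Polynomial ℝ :=
    (Matrix.det (1 + (Polynomial.X : Polynomial ℝ) • M.map Polynomial.C)).divX.divX with hp
  have hlim : Filter.Tendsto (fun t : ℝ => M.trace + p.eval t * t) (nhdsWithin 0 (Set.Ioi 0))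
      (nhds M.trace) := by
    have : Continuous fun t : ℝ => M.trace + p.eval t * t := by fun_prop
    simpa using (this.tendsto 0).mono_left nhdsWithin_le_nhds
  refine le_of_tendsto hlim ?_
  filter_upwards [Ioo_mem_nhdsGT one_pos] with t ht
  have := h t ht.1 ht.2
  rw [Matrix.det_one_add_smul] at this
  have h3 : t * (M.trace + p.eval t * t) ≤ 0 := by rw [hp]; linarith
  exact nonpos_of_mul_nonpos_right h3 ht.1

theorem trace_le_of_image_closedBall_subset (hc : Convex ℝ K) (hr : 0 < r)
    (hrK : Metric.closedBall 0 r ⊆ K)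
    (hmax : ∀ A : Set (EuclideanSpace ℝ (Fin n)), IsEllipsoid A → A ⊆ K →
      volume A ≤ volume (Metric.closedBall (0 : EuclideanSpace ℝ (Fin n)) r))
    {T : EuclideanSpace ℝ (Fin n) →ₗ[ℝ] EuclideanSpace ℝ (Fin n)}
    (hT : T '' Metric.closedBall 0 1 ⊆ K) : LinearMap.trace ℝ _ T ≤ n * r := by
  let b := (EuclideanSpace.basisFun (Fin n) ℝ).toBasis
  set S : EuclideanSpace ℝ (Fin n) →ₗ[ℝ] EuclideanSpace ℝ (Fin n) := r⁻¹ • T - 1 with hS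
  have htr := trace_le_of_forall_det_one_add_smul_le (M := LinearMap.toMatrix b b S) (by
    intro t ht0 ht1
    have hdet := abs_det_le_of_image_subset hr hmax (T := r • (1 + t • S)) (by
      rintro _ ⟨v, hv, rfl⟩
      have hrv : r • v ∈ K := hrK (by
        rw [mem_closedBall_zero_iff] at hv ⊢
        rw [norm_smul, Real.norm_of_nonneg hr.le]
        exact mul_le_of_le_one_right hr.le hv)
      have := hc hrv (hT ⟨v, hv, rfl⟩) (sub_nonneg.2 ht1.le) ht0.le (by ring)
      convert this using 1
      simp only [hS, LinearMap.smul_apply, LinearMap.add_apply, LinearMap.sub_apply,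
        Module.End.one_apply, smul_add, smul_sub, smul_smul]
      rw [show r * (t * r⁻¹) = t by field_simp]
      module)
    rw [LinearMap.det_smul, finrank_euclideanSpace_fin, abs_mul, abs_of_pos (pow_pos hr n)] at hdet
    have h1 : |LinearMap.det (1 + t • S)| ≤ 1 :=
      le_of_mul_le_mul_left (by simpa using hdet) (pow_pos hr n)
    have h2 := (le_abs_self _).trans h1
    rw [← LinearMap.det_toMatrix b] at h2
    simpa [LinearMap.toMatrix_one] using h2)
  rw [← LinearMap.trace_eq_matrix_trace ℝ b, hS, map_sub, map_smul, LinearMap.trace_one,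
    finrank_euclideanSpace_fin, smul_eq_mul, sub_nonpos, inv_mul_le_iff₀ hr] at htr
  linarith

/-- The first-order John condition: in John's position with inradius `r`, a quadratic form that is
nonpositive at every `u` with `1/2 ≤ ‖u‖` and `‖u‖*_K ≤ r` has nonpositive trace. -/
theorem trace_nonpos_of_inner_self_nonpos (hn : 0 < n) (hK : IsCompact K) (hc : Convex ℝ K)
    (hr : 0 < r) (hrK : Metric.closedBall 0 r ⊆ K)
    (hmax : ∀ A : Set (EuclideanSpace ℝ (Fin n)), IsEllipsoid A → A ⊆ K →
      volume A ≤ volume (Metric.closedBall (0 : EuclideanSpace ℝ (Fin n)) r))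
    (B : EuclideanSpace ℝ (Fin n) →L[ℝ] EuclideanSpace ℝ (Fin n))
    (hB : ∀ u, 1 / 2 ≤ ‖u‖ → dualNorm K u ≤ r → ⟪u, B u⟫ ≤ 0) :
    LinearMap.trace ℝ _ (B : EuclideanSpace ℝ (Fin n) →ₗ[ℝ] EuclideanSpace ℝ (Fin n)) ≤ 0 := by
  have h0 : K ∈ nhds 0 := Filter.mem_of_superset (Metric.closedBall_mem_nhds _ hr) hrK
  set M := ‖B‖
  have hM : 0 ≤ M := norm_nonneg B
  have hBM : ∀ u w, ‖u‖ ≤ 1 → ⟪u, B w⟫ ≤ M * ‖w‖ := fun u w hu =>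
    (real_inner_le_norm _ _).trans <| by
      have h1 := B.le_opNorm w
      have h2 := mul_le_mul hu h1 (norm_nonneg _) zero_le_one
      linarith
  have key : ∀ δ : ℝ, 0 < δ →
      LinearMap.trace ℝ _ (B : EuclideanSpace ℝ (Fin n) →ₗ[ℝ] EuclideanSpace ℝ (Fin n)) ≤ n * δ := by
    intro δ hδ
    set l := M ^ 2 / (2 * δ) + 2 * M with hl
    have hl0 : 0 ≤ l := by positivity
    have hlM : 2 * M ≤ l := by rw [hl]; linarith [show 0 ≤ M ^ 2 / (2 * δ) by positivity]
    have hlδ : M ^ 2 ≤ 2 * (l * δ) := by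
      have : M ^ 2 / (2 * δ) * (2 * δ) = M ^ 2 := by field_simp
      rw [hl]
      nlinarith [mul_nonneg hM hδ.le]
    have hlδ0 : 0 < l + δ := by linarith
    have hpair : ∀ u v : EuclideanSpace ℝ (Fin n), dualNorm K u ≤ r → ‖v‖ ≤ 1 →
        ⟪u, B v⟫ + l * ⟪u, v⟫ ≤ l + δ := by
      intro u v hu hv
      have hu1 : ‖u‖ ≤ 1 := by
        have := (mul_norm_le_dualNorm hK hr.le hrK u).trans hu
        exact le_of_mul_le_mul_left (by simpa using this) hr
      rcases le_total (1 / 2) ‖u‖ with h | h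
      · have h1 := hB u h hu
        have h2 := hBM u (v - u) hu1
        have h3 : ‖v - u‖ ^ 2 ≤ 2 * (1 - ⟪u, v⟫) := by
          rw [norm_sub_sq_real, real_inner_comm]
          nlinarith [norm_nonneg u, norm_nonneg v]
        rw [map_sub, inner_sub_right] at h2
        have h4 : M * ‖v - u‖ ≤ l * (‖v - u‖ ^ 2 / 2) + δ := by
          refine abs_le_of_sq_le_sq' ?_ (by positivity) |>.2
          nlinarith [sq_nonneg (l * (‖v - u‖ ^ 2 / 2) - δ),
            mul_le_mul_of_nonneg_right hlδ (sq_nonneg ‖v - u‖)]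
        nlinarith [mul_le_mul_of_nonneg_left h3 hl0]
      · have h1 := hBM u v hu1
        have h2 : ⟪u, v⟫ ≤ 1 / 2 := (real_inner_le_norm _ _).trans <| by
          nlinarith [norm_nonneg u, norm_nonneg v]
        nlinarith [mul_le_mul_of_nonneg_left h2 hl0, mul_le_mul_of_nonneg_left hv hM]
    have htr := trace_le_of_image_closedBall_subset hc hr hrK hmax
      (image_closedBall_subset_of_inner_le hK hc hr h0
        (T := (r / (l + δ)) • ((B : EuclideanSpace ℝ (Fin n) →ₗ[ℝ] EuclideanSpace ℝ (Fin n)) + l • 1))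
        (by
          intro u v hu hv
          have := hpair u v hu hv
          simp only [LinearMap.smul_apply, LinearMap.add_apply, Module.End.one_apply,
            inner_smul_right, inner_add_right, ContinuousLinearMap.coe_coe]
          rw [div_mul_eq_mul_div, div_le_iff₀ hlδ0]
          exact mul_le_mul_of_nonneg_left this hr.le))
    rw [map_smul, map_add, map_smul, LinearMap.trace_one, finrank_euclideanSpace_fin,
      smul_eq_mul, smul_eq_mul, div_mul_eq_mul_div, div_le_iff₀ hlδ0] at htr
    have : r * (LinearMap.trace ℝ _ (B : EuclideanSpace ℝ (Fin n) →ₗ[ℝ] EuclideanSpace ℝ (Fin n))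
        + l * n) ≤ r * (n * (l + δ)) := by linarith
    have := le_of_mul_le_mul_left this hr
    linarith
  refine le_of_forall_pos_le_add fun ε hε => ?_
  have hn' : (0 : ℝ) < n := by exact_mod_cast hn
  have := key (ε / n) (by positivity)
  rwa [mul_div_cancel₀ _ hn'.ne', ← zero_add ε] at this

end John

section SphereAverage

variable {n : ℕ} {K : Set (EuclideanSpace ℝ (Fin n))} {α r : ℝ}
  {y : EuclideanSpace ℝ (Fin n) → EuclideanSpace ℝ (Fin n)}

theorem IsTwoConvex.continuousOn_sphere_of_inner_eq_dualNorm (hK : IsCompact K) (hc : Convex ℝ K)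
    (hsymm : K = -K) (hr : 0 < r) (hrK : Metric.closedBall 0 r ⊆ K) (hα : IsTwoConvex K α)
    (hα0 : 0 < α) (hy : ∀ θ, y θ ∈ K) (hyθ : ∀ θ, ⟪θ, y θ⟫ = dualNorm K θ) :
    ContinuousOn y (Metric.sphere 0 1) := by
  have h0 : K ∈ nhds 0 := Filter.mem_of_superset (Metric.closedBall_mem_nhds _ hr) hrK
  obtain ⟨R, hR0, hR⟩ := hK.isBounded.subset_closedBall_lt 0 0
  have hL : 0 ≤ R ^ 2 / (4 * α * r) := by positivity
  refine (LipschitzOnWith.of_dist_le_mul (K := .mk (R ^ 2 / (4 * α * r)) hL) ?_).continuousOn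
  intro θ hθ θ' hθ'
  rw [mem_sphere_zero_iff_norm] at hθ hθ'
  rw [dist_eq_norm, dist_eq_norm, NNReal.coe_mk, div_mul_eq_mul_div, le_div_iff₀ (by positivity)]
  have h1 := hα.mul_gauge_sq_le_inner hK hc hsymm h0 (hy θ) (hy θ') (hyθ θ) (hyθ θ')
  have h2 := h1.trans (real_inner_le_norm _ _)
  have h3 := le_gauge_of_subset_closedBall (absorbent_nhds_zero h0) hR0.le hR (x := y θ - y θ')
  rw [div_le_iff₀ hR0] at h3
  have h4 := mul_norm_le_dualNorm hK hr.le hrK θ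
  have h5 := mul_norm_le_dualNorm hK hr.le hrK θ'
  rw [hθ] at h4
  rw [hθ'] at h5
  set g := gauge K (y θ - y θ')
  set d := ‖y θ - y θ'‖
  have hd0 : 0 ≤ d := norm_nonneg _
  rcases hd0.eq_or_lt with hd | hd
  · rw [← hd, zero_mul]; positivity
  have h6 : d ^ 2 ≤ R ^ 2 * g ^ 2 := by
    rw [← mul_pow, mul_comm R]; exact pow_le_pow_left₀ hd0 h3 2
  have h7 : 4 * α * r * g ^ 2 ≤ ‖θ - θ'‖ * d := by
    refine le_trans ?_ h2
    have := mul_le_mul_of_nonneg_left (show 2 * r ≤ dualNorm K θ + dualNorm K θ' by linarith)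
      (show 0 ≤ 2 * α * g ^ 2 by positivity)
    linarith
  refine le_of_mul_le_mul_right ?_ hd
  have h8 := mul_le_mul_of_nonneg_left h6 (show 0 ≤ 4 * α * r by positivity)
  have h9 := mul_le_mul_of_nonneg_left h7 (sq_nonneg R)
  linarith

theorem continuous_dualNorm (hK : IsCompact K) (hne : K.Nonempty) : Continuous (dualNorm K) := by
  obtain ⟨R, hR0, hR⟩ := hK.isBounded.subset_closedBall_lt 0 0
  refine (LipschitzWith.of_le_add_mul (.mk R hR0.le) fun θ θ' => ?_).continuous
  refine dualNorm_le hne fun z hz => ?_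
  have h1 := inner_le_dualNorm (θ := θ') hK hz
  have h2 := real_inner_le_norm (θ - θ') z
  have h3 : ‖z‖ ≤ R := by simpa using hR hz
  have h4 := mul_le_mul_of_nonneg_left h3 (norm_nonneg (θ - θ'))
  rw [inner_sub_left] at h2
  rw [dist_eq_norm, NNReal.coe_mk]
  linarith

theorem reflection_orthogonal_span_singleton_apply (u θ : EuclideanSpace ℝ (Fin n)) :
    (ℝ ∙ u)ᗮ.reflection θ = θ - (2 * ⟪θ, u⟫ / ‖u‖ ^ 2) • u := by
  rw [Submodule.reflection_orthogonal_apply, Submodule.reflection_singleton_apply,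
    real_inner_comm, neg_sub, ← Nat.cast_smul_eq_nsmul ℝ, smul_smul]
  simp [mul_div_assoc]

theorem IsTwoConvex.inner_mul_inner_sub_reflection_le (hn : 0 < n) (hK : IsCompact K)
    (hc : Convex ℝ K) (hsymm : K = -K) (hr : 0 < r) (hrK : Metric.closedBall 0 r ⊆ K)
    (hα : IsTwoConvex K α) (hα0 : 0 < α) (hy : ∀ θ, y θ ∈ K)
    (hyθ : ∀ θ, ⟪θ, y θ⟫ = dualNorm K θ) {u : EuclideanSpace ℝ (Fin n)} (hu : 1 / 2 ≤ ‖u‖)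
    (hur : dualNorm K u ≤ r) (θ : EuclideanSpace ℝ (Fin n)) :
    ⟪θ, u⟫ * (⟪dualNorm K θ • y θ, u⟫ -
      ⟪dualNorm K ((ℝ ∙ u)ᗮ.reflection θ) • y ((ℝ ∙ u)ᗮ.reflection θ), u⟫) ≤
      4 * (r ^ 2 / α) * ⟪θ, u⟫ ^ 2 := by
  have h0 : K ∈ nhds 0 := Filter.mem_of_superset (Metric.closedBall_mem_nhds _ hr) hrK
  have h4α := hα.four_mul_le_one hn hK hc hsymm hr hrK
  set θ' := (ℝ ∙ u)ᗮ.reflection θ with hθ'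
  set a := ⟪θ, u⟫ with ha
  set c := 2 * a / ‖u‖ ^ 2 with hc'
  have hdiff : θ - θ' = c • u := by
    rw [hθ', reflection_orthogonal_span_singleton_apply, sub_sub_cancel]
  have hca : |c| ≤ 8 * |a| := by
    have hu2 : 1 / 4 ≤ ‖u‖ ^ 2 := by nlinarith
    rw [hc', abs_div, abs_mul, abs_two, abs_of_nonneg (sq_nonneg ‖u‖), div_le_iff₀ (by linarith)]
    nlinarith [abs_nonneg a]
  have h1 := hα.mul_gauge_sq_le_inner hK hc hsymm h0 (hy θ) (hy θ') (hyθ θ) (hyθ θ')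
  rw [hdiff, real_inner_smul_left] at h1
  have hg0 : 0 ≤ gauge K (y θ - y θ') := gauge_nonneg _
  set g := gauge K (y θ - y θ')
  have hd : |⟪u, y θ - y θ'⟫| ≤ r * g :=
    (abs_inner_le_dualNorm_mul_gauge hK hc hsymm h0 _ _).trans
      (mul_le_mul_of_nonneg_right hur hg0)
  have hp : |⟪u, y θ⟫| ≤ r := (abs_inner_le_dualNorm hK hsymm (hy θ)).trans hur
  have hq : |⟪u, y θ'⟫| ≤ r := (abs_inner_le_dualNorm hK hsymm (hy θ')).trans hur
  have hh : dualNorm K θ - dualNorm K θ' ≤ c * ⟪u, y θ⟫ := by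
    have := inner_le_dualNorm (θ := θ') hK (hy θ)
    rw [← real_inner_smul_left, ← hdiff, inner_sub_left, hyθ]
    linarith
  have hh' : c * ⟪u, y θ'⟫ ≤ dualNorm K θ - dualNorm K θ' := by
    have := inner_le_dualNorm (θ := θ) hK (hy θ')
    rw [← real_inner_smul_left, ← hdiff, inner_sub_left, hyθ]
    linarith
  have hs : 0 ≤ dualNorm K θ + dualNorm K θ' := by
    have h1 := mul_norm_le_dualNorm hK hr.le hrK θ
    have h2 := mul_norm_le_dualNorm hK hr.le hrK θ'
    have := norm_nonneg θ
    have := norm_nonneg θ'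
    nlinarith
  rw [real_inner_smul_left, real_inner_smul_left, real_inner_comm, real_inner_comm u (y θ')]
  rw [inner_sub_right] at h1 hd
  set p := ⟪u, y θ⟫
  set q := ⟪u, y θ'⟫
  set h := dualNorm K θ
  set h' := dualNorm K θ'
  have hA := abs_nonneg a
  have hcr : ∀ t, |t| ≤ r → |c * t| ≤ 8 * |a| * r := fun t ht => by
    rw [abs_mul]; exact mul_le_mul hca ht (abs_nonneg _) (by positivity)
  have habs : |h - h'| ≤ 8 * |a| * r := by
    refine abs_le.2 ⟨?_, ?_⟩
    · linarith [neg_abs_le (c * q), hcr q hq]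
    · linarith [le_abs_self (c * p), hcr p hp]
  have hgs : α * (g * (h + h')) ≤ 4 * |a| * r := by
    rcases hg0.eq_or_lt with hg | hg
    · rw [← hg]; simp; positivity
    have h2 : c * (p - q) ≤ 8 * |a| * (r * g) := (le_abs_self _).trans <| by
      rw [abs_mul]; exact mul_le_mul hca hd (abs_nonneg _) (by positivity)
    refine le_of_mul_le_mul_right ?_ hg
    linarith
  have hfin : |h * p - h' * q| ≤ 4 * (r ^ 2 / α) * |a| := by
    have e : h * p - h' * q = ((h + h') * (p - q) + (h - h') * (p + q)) / 2 := by ring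
    have e1 : |(h + h') * (p - q)| ≤ (h + h') * (r * g) := by
      rw [abs_mul, abs_of_nonneg hs]; exact mul_le_mul_of_nonneg_left hd hs
    have e2 : |(h - h') * (p + q)| ≤ 8 * |a| * r * (2 * r) := by
      rw [abs_mul]
      exact mul_le_mul habs ((abs_add_le _ _).trans (by linarith)) (abs_nonneg _) (by positivity)
    have e3 : (h + h') * (r * g) ≤ 4 * |a| * r * r / α := by
      rw [le_div_iff₀ hα0]
      have := mul_le_mul_of_nonneg_right hgs hr.le
      linarith
    have e4 : 16 * |a| * r * r ≤ 4 * |a| * r * r / α := by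
      rw [le_div_iff₀ hα0]
      have := mul_le_mul_of_nonneg_left h4α (show 0 ≤ 4 * |a| * r * r by positivity)
      linarith
    rw [e, abs_div, abs_two, div_le_iff₀ two_pos]
    refine (abs_add_le _ _).trans ?_
    have e5 : 4 * (r ^ 2 / α) * |a| * 2 = 2 * (4 * |a| * r * r / α) := by ring
    rw [e5]
    linarith
  calc a * (h * p - h' * q) ≤ |a| * |h * p - h' * q| := by
        rw [← abs_mul]; exact le_abs_self _
    _ ≤ |a| * (4 * (r ^ 2 / α) * |a|) := mul_le_mul_of_nonneg_left hfin hA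
    _ = 4 * (r ^ 2 / α) * a ^ 2 := by rw [← sq_abs a]; ring

theorem integrable_of_continuousOn_sphere {F : Type*} [NormedAddCommGroup F]
    {ν : Measure (EuclideanSpace ℝ (Fin n))} [IsFiniteMeasure ν]
    (hν : ∀ᵐ θ ∂ν, θ ∈ Metric.sphere (0 : EuclideanSpace ℝ (Fin n)) 1)
    {f : EuclideanSpace ℝ (Fin n) → F} (hf : ContinuousOn f (Metric.sphere 0 1)) :
    Integrable f ν := by
  have := hf.integrableOn_compact (μ := ν) (isCompact_sphere _ _)
  rwa [IntegrableOn, Measure.restrict_eq_self_of_ae_mem hν] at this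

theorem IsTwoConvex.integral_inner_mul_inner_le (hn : 0 < n) (hK : IsCompact K)
    (hc : Convex ℝ K) (hsymm : K = -K) (hr : 0 < r) (hrK : Metric.closedBall 0 r ⊆ K)
    (hα : IsTwoConvex K α) (hα0 : 0 < α) (hy : ∀ θ, y θ ∈ K)
    (hyθ : ∀ θ, ⟪θ, y θ⟫ = dualNorm K θ) {ν : Measure (EuclideanSpace ℝ (Fin n))}
    [IsFiniteMeasure ν] (hν : ∀ᵐ θ ∂ν, θ ∈ Metric.sphere (0 : EuclideanSpace ℝ (Fin n)) 1)
    (hinv : ∀ e : EuclideanSpace ℝ (Fin n) ≃ₗᵢ[ℝ] EuclideanSpace ℝ (Fin n),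
      MeasurePreserving e ν ν)
    {u : EuclideanSpace ℝ (Fin n)} (hu : 1 / 2 ≤ ‖u‖) (hur : dualNorm K u ≤ r) :
    ∫ θ, ⟪θ, u⟫ * ⟪dualNorm K θ • y θ, u⟫ ∂ν ≤ 2 * (r ^ 2 / α) * ∫ θ, ⟪θ, u⟫ ^ 2 ∂ν := by
  have hycont := hα.continuousOn_sphere_of_inner_eq_dualNorm hK hc hsymm hr hrK hα0 hy hyθ
  have hhcont := continuous_dualNorm hK ⟨_, hy 0⟩
  set R := (ℝ ∙ u)ᗮ.reflection
  have hG : Integrable (fun θ => ⟪θ, u⟫ * ⟪dualNorm K θ • y θ, u⟫) ν :=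
    integrable_of_continuousOn_sphere hν (by fun_prop)
  have hQ : Integrable (fun θ => ⟪θ, u⟫ ^ 2) ν :=
    integrable_of_continuousOn_sphere hν (by fun_prop)
  have hemb : MeasurableEmbedding R := R.toHomeomorph.measurableEmbedding
  have hGR : Integrable (fun θ => ⟪R θ, u⟫ * ⟪dualNorm K (R θ) • y (R θ), u⟫) ν :=
    ((hinv R).integrable_comp_emb hemb).2 hG
  have hinvint : ∫ θ, ⟪R θ, u⟫ * ⟪dualNorm K (R θ) • y (R θ), u⟫ ∂ν =
      ∫ θ, ⟪θ, u⟫ * ⟪dualNorm K θ • y θ, u⟫ ∂ν :=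
    (hinv R).integral_comp hemb fun θ => ⟪θ, u⟫ * ⟪dualNorm K θ • y θ, u⟫
  have hRu : ∀ θ, ⟪R θ, u⟫ = -⟪θ, u⟫ := fun θ => by
    have hu0 : ‖u‖ ^ 2 ≠ 0 := by positivity
    rw [reflection_orthogonal_span_singleton_apply, inner_sub_left, real_inner_smul_left,
      real_inner_self_eq_norm_sq, div_mul_cancel₀ _ hu0]
    ring
  have hle : ∫ θ, (⟪θ, u⟫ * ⟪dualNorm K θ • y θ, u⟫ +
      ⟪R θ, u⟫ * ⟪dualNorm K (R θ) • y (R θ), u⟫) ∂ν ≤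
      ∫ θ, 4 * (r ^ 2 / α) * ⟪θ, u⟫ ^ 2 ∂ν := by
    refine integral_mono (hG.add hGR) (hQ.const_mul _) fun θ => ?_
    have := hα.inner_mul_inner_sub_reflection_le hn hK hc hsymm hr hrK hα0 hy hyθ hu hur θ
    simp only [hRu]
    linarith
  rw [integral_add hG hGR, hinvint, integral_const_mul] at hle
  linarith

theorem exists_continuousLinearMap_inner_eq_integral
    {ν : Measure (EuclideanSpace ℝ (Fin n))} [IsFiniteMeasure ν]
    (hν : ∀ᵐ θ ∂ν, θ ∈ Metric.sphere (0 : EuclideanSpace ℝ (Fin n)) 1)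
    {ψ : EuclideanSpace ℝ (Fin n) → EuclideanSpace ℝ (Fin n)}
    (hψ : ContinuousOn ψ (Metric.sphere 0 1)) :
    ∃ B : EuclideanSpace ℝ (Fin n) →L[ℝ] EuclideanSpace ℝ (Fin n),
      (∀ u v, ⟪u, B v⟫ = ∫ θ, ⟪θ, v⟫ * ⟪u, ψ θ⟫ ∂ν) ∧
      LinearMap.trace ℝ _ (B : EuclideanSpace ℝ (Fin n) →ₗ[ℝ] EuclideanSpace ℝ (Fin n)) =
        ∫ θ, ⟪θ, ψ θ⟫ ∂ν := by
  have hcont : ContinuousOn (fun θ => (innerSL ℝ θ).smulRight (ψ θ)) (Metric.sphere 0 1) := by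
    let L := ContinuousLinearMap.smulRightL ℝ (EuclideanSpace ℝ (Fin n)) (EuclideanSpace ℝ (Fin n))
    have hL : ContinuousOn (fun θ => L (innerSL ℝ θ)) (Metric.sphere 0 1) := by fun_prop
    exact hL.clm_apply hψ
  have hb := integrable_of_continuousOn_sphere hν hcont
  have happ : ∀ u v, ⟪u, (∫ θ, (innerSL ℝ θ).smulRight (ψ θ) ∂ν) v⟫ =
      ∫ θ, ⟪θ, v⟫ * ⟪u, ψ θ⟫ ∂ν := fun u v => by
    rw [ContinuousLinearMap.integral_apply hb, ← integral_inner (hb.apply_continuousLinearMap v)]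
    simp [inner_smul_right]
  refine ⟨_, happ, ?_⟩
  rw [LinearMap.trace_eq_sum_inner _ (EuclideanSpace.basisFun (Fin n) ℝ)]
  simp only [ContinuousLinearMap.coe_coe, happ]
  rw [← integral_finsetSum _ fun i _ => integrable_of_continuousOn_sphere hν (by fun_prop)]
  congr 1 with θ
  exact (EuclideanSpace.basisFun (Fin n) ℝ).sum_inner_mul_inner _ _

theorem IsTwoConvex.integral_dualNorm_sq_le (hn : 0 < n) (hK : IsCompact K)
    (hc : Convex ℝ K) (hsymm : K = -K) (hr : 0 < r) (hrK : Metric.closedBall 0 r ⊆ K)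
    (hmax : ∀ A : Set (EuclideanSpace ℝ (Fin n)), IsEllipsoid A → A ⊆ K →
      volume A ≤ volume (Metric.closedBall (0 : EuclideanSpace ℝ (Fin n)) r))
    (hα : IsTwoConvex K α) (hα0 : 0 < α) {ν : Measure (EuclideanSpace ℝ (Fin n))}
    [IsFiniteMeasure ν]
    (hν : ∀ᵐ θ ∂ν, θ ∈ Metric.sphere (0 : EuclideanSpace ℝ (Fin n)) 1)
    (hinv : ∀ e : EuclideanSpace ℝ (Fin n) ≃ₗᵢ[ℝ] EuclideanSpace ℝ (Fin n),
      MeasurePreserving e ν ν) :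
    ∫ θ, dualNorm K θ ^ 2 ∂ν ≤ 2 * (r ^ 2 / α) * ν.real Set.univ := by
  have h0 : K ∈ nhds 0 := Filter.mem_of_superset (Metric.closedBall_mem_nhds _ hr) hrK
  have hne : K.Nonempty := ⟨0, mem_of_mem_nhds h0⟩
  choose y hy hyθ using exists_inner_eq_dualNorm hK hne
  have hycont := hα.continuousOn_sphere_of_inner_eq_dualNorm hK hc hsymm hr hrK hα0 hy hyθ
  have hhcont := continuous_dualNorm hK hne
  set D := 2 * (r ^ 2 / α) with hD
  set φ : EuclideanSpace ℝ (Fin n) → EuclideanSpace ℝ (Fin n) := fun θ => dualNorm K θ • y θ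
  have hφ : ContinuousOn φ (Metric.sphere 0 1) := hhcont.continuousOn.smul hycont
  set ψ : EuclideanSpace ℝ (Fin n) → EuclideanSpace ℝ (Fin n) := fun θ => φ θ - D • θ
  have hψ : ContinuousOn ψ (Metric.sphere 0 1) := hφ.sub (by fun_prop)
  obtain ⟨B, happ, htrB⟩ := exists_continuousLinearMap_inner_eq_integral hν hψ
  have htr := trace_nonpos_of_inner_self_nonpos hn hK hc hr hrK hmax B (by
    intro u hu hur
    rw [happ]
    have hG : Integrable (fun θ => ⟪θ, u⟫ * ⟪φ θ, u⟫) ν :=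
      integrable_of_continuousOn_sphere hν (by fun_prop)
    have hQ : Integrable (fun θ => ⟪θ, u⟫ ^ 2) ν :=
      integrable_of_continuousOn_sphere hν (by fun_prop)
    have hle := hα.integral_inner_mul_inner_le hn hK hc hsymm hr hrK hα0 hy hyθ hν hinv hu hur
    have : ∫ θ, ⟪θ, u⟫ * ⟪u, ψ θ⟫ ∂ν = ∫ θ, (⟪θ, u⟫ * ⟪φ θ, u⟫ - D * ⟪θ, u⟫ ^ 2) ∂ν := by
      congr 1 with θ
      simp only [ψ, inner_sub_right, inner_smul_right]
      rw [real_inner_comm u (φ θ), real_inner_comm u θ]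
      ring
    rw [this, integral_sub hG (hQ.const_mul _), integral_const_mul]
    exact sub_nonpos.2 hle)
  have hsum : ∫ θ, ⟪θ, ψ θ⟫ ∂ν = ∫ θ, (dualNorm K θ ^ 2 - D) ∂ν := by
    refine integral_congr_ae ?_
    filter_upwards [hν] with θ hθ
    rw [mem_sphere_zero_iff_norm] at hθ
    simp only [ψ, φ, inner_sub_right, inner_smul_right, hyθ, real_inner_self_eq_norm_sq, hθ]
    ring
  have hsq : Integrable (fun θ => dualNorm K θ ^ 2) ν :=
    integrable_of_continuousOn_sphere hν (by fun_prop)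
  rw [htrB, hsum, integral_sub hsq (integrable_const _), integral_const, smul_eq_mul] at htr
  linarith

theorem IsTwoConvex.integral_dualNorm_le (hn : 0 < n) (hK : IsCompact K)
    (hc : Convex ℝ K) (hsymm : K = -K) (hr : 0 < r) (hrK : Metric.closedBall 0 r ⊆ K)
    (hmax : ∀ A : Set (EuclideanSpace ℝ (Fin n)), IsEllipsoid A → A ⊆ K →
      volume A ≤ volume (Metric.closedBall (0 : EuclideanSpace ℝ (Fin n)) r))
    (hα : IsTwoConvex K α) (hα0 : 0 < α) {ν : Measure (EuclideanSpace ℝ (Fin n))}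
    (hν1 : ν Set.univ ≤ 1)
    (hν : ∀ᵐ θ ∂ν, θ ∈ Metric.sphere (0 : EuclideanSpace ℝ (Fin n)) 1)
    (hinv : ∀ e : EuclideanSpace ℝ (Fin n) ≃ₗᵢ[ℝ] EuclideanSpace ℝ (Fin n),
      MeasurePreserving e ν ν) :
    ∫ θ, dualNorm K θ ∂ν ≤ 2 * (r / √α) := by
  have : IsFiniteMeasure ν := ⟨hν1.trans_lt ENNReal.one_lt_top⟩
  have hνr : ν.real Set.univ ≤ 1 := ENNReal.toReal_le_of_le_ofReal zero_le_one (by simpa using hν1)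
  have hhcont := continuous_dualNorm hK ⟨0, hrK (Metric.mem_closedBall_self hr.le)⟩
  have hsq : Integrable (fun θ => dualNorm K θ ^ 2) ν :=
    integrable_of_continuousOn_sphere hν (by fun_prop)
  have hsq_le := hα.integral_dualNorm_sq_le hn hK hc hsymm hr hrK hmax hα0 hν hinv
  set s := r / √α with hs
  have hs0 : 0 < s := by positivity
  have hDs : r ^ 2 / α = s ^ 2 := by rw [hs, div_pow, Real.sq_sqrt hα0.le]
  have hamgm : ∫ θ, 2 * s * dualNorm K θ ∂ν ≤ ∫ θ, (dualNorm K θ ^ 2 + s ^ 2) ∂ν := by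
    refine integral_mono ((integrable_of_continuousOn_sphere hν hhcont.continuousOn).const_mul _)
      (hsq.add (integrable_const _)) fun θ => ?_
    have := two_mul_le_add_sq s (dualNorm K θ)
    simp only
    linarith
  rw [integral_const_mul, integral_add hsq (integrable_const _), integral_const, smul_eq_mul]
    at hamgm
  refine le_of_mul_le_mul_left ?_ (show 0 < 2 * s by positivity)
  have := mul_le_mul_of_nonneg_right hνr (sq_nonneg s)
  rw [hDs] at hsq_le
  nlinarith

end SphereAverage

section SphereMeasure

variable {n : ℕ}

theorem sphereMeasure_univ_le_one (n : ℕ) : sphereMeasure n Set.univ ≤ 1 := by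
  rw [sphereMeasure, Measure.smul_apply, Measure.restrict_apply_univ, smul_eq_mul]
  exact ENNReal.inv_mul_le_one _

theorem ae_sphereMeasure_mem_sphere (n : ℕ) :
    ∀ᵐ θ ∂sphereMeasure n, θ ∈ Metric.sphere (0 : EuclideanSpace ℝ (Fin n)) 1 :=
  Measure.ae_smul_measure (ae_restrict_mem Metric.isClosed_sphere.measurableSet) _

theorem measurePreserving_sphereMeasure
    (e : EuclideanSpace ℝ (Fin n) ≃ₗᵢ[ℝ] EuclideanSpace ℝ (Fin n)) :
    MeasurePreserving e (sphereMeasure n) (sphereMeasure n) := by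
  have h := (e.toIsometryEquiv.measurePreserving_hausdorffMeasure ((n : ℝ) - 1)).restrict_preimage
    (Metric.isClosed_sphere (x := (0 : EuclideanSpace ℝ (Fin n))) (ε := 1)).measurableSet
  have hpre : e.toIsometryEquiv ⁻¹' Metric.sphere (0 : EuclideanSpace ℝ (Fin n)) 1 =
      Metric.sphere 0 1 := by
    ext; simp
  rw [hpre] at h
  exact h.smul_measure _

end SphereMeasure

theorem twoConvex_john_MStar_b_bound :
    ∃ C : ℝ, 0 < C ∧ ∀ (n : ℕ) (K : Set (EuclideanSpace ℝ (Fin n))) (α : ℝ),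
      0 < n → IsSymmConvexBody K → 0 < α → IsTwoConvex K α →
      InJohnPosition K →
      MStar K * sSup (gauge K '' Metric.sphere (0 : EuclideanSpace ℝ (Fin n)) 1) ≤
        C / Real.sqrt α := by
  refine ⟨2, two_pos, fun n K α hn ⟨hK, hc, _, hsymm⟩ hα0 hα ⟨r, hr, hrK, hmax⟩ => ?_⟩
  have hM : MStar K ≤ 2 * (r / √α) :=
    hα.integral_dualNorm_le hn hK hc hsymm hr hrK hmax hα0 (sphereMeasure_univ_le_one n)
      (ae_sphereMeasure_mem_sphere n) measurePreserving_sphereMeasure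
  have hb : sSup (gauge K '' Metric.sphere (0 : EuclideanSpace ℝ (Fin n)) 1) ≤ r⁻¹ := by
    refine Real.sSup_le ?_ (by positivity)
    rintro _ ⟨θ, hθ, rfl⟩
    refine gauge_le_of_mem (by positivity) ((Set.mem_inv_smul_set_iff₀ hr.ne' _ _).2 (hrK ?_))
    rw [mem_sphere_zero_iff_norm] at hθ
    rw [mem_closedBall_zero_iff, norm_smul, hθ, mul_one, Real.norm_of_nonneg hr.le]
  have hb0 : 0 ≤ sSup (gauge K '' Metric.sphere (0 : EuclideanSpace ℝ (Fin n)) 1) :=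
    Real.sSup_nonneg (by rintro _ ⟨θ, -, rfl⟩; exact gauge_nonneg θ)
  calc _ ≤ 2 * (r / √α) * r⁻¹ := mul_le_mul hM hb hb0 (by positivity)
    _ = 2 / √α := by field_simp
end
end
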